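/- Let w = (2, w_2, w_3, …, w_n) ∈ 𝒮_n and w' = (2, w_3, …, w_n, w_2). If the complex ⟦w_2, w_3−1, …, w_n−1⟧ (a weight summand of Λ^*𝔫𝔦𝔩_{n−1}) has vanishing homology in all degrees, then H_k⟦w⟧ ≅ H_{k−(2w_2−n−2)}⟦w'⟧ for all k, i.e. H_*⟦w⟧ ≅ H_*⟦w'⟧ with degrees shifted by 2w_2 − n − 2. -/

import Mathlib

namespace Nil

/-- Index pairs `(a,b)` with `a < b` in `Fin n`, indexing the basis `e_{ab}` of `nil_n`. -/
abbrev P (n : ℕ) : Type := {p : Fin n × Fin n // p.1 < p.2}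

/-- Lexicographic key of a pair. -/
def key {n : ℕ} (p : P n) : ℕ := p.1.1.1 * n + p.1.2.1

/-- Position (0-based) of `a` in the lexicographically sorted list of `M`. -/
def pos {n : ℕ} (M : Finset (P n)) (a : P n) : ℕ :=
  (M.filter fun b => key b < key a).card

/-- Basis of the degree `k` part of the Chevalley-Eilenberg complex `Λ^* nil_n`:
subsets `M` of pairs with `|M| = k` (empty for `k < 0`). -/
abbrev B (n : ℕ) (k : ℤ) : Type := {M : Finset (P n) // (M.card : ℤ) = k}

/-- Degree `k` chain group of the Chevalley-Eilenberg complex of `nil_n`. -/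
abbrev C (n : ℕ) (k : ℤ) : Type := B n k →₀ ℤ

/-- The Chevalley-Eilenberg boundary of a basis wedge `e_M`:
`∂(e_{a₁b₁} ∧ … ∧ e_{aₖbₖ}) = Σ_{i<j} (-1)^{i+j} [e_{aᵢbᵢ}, e_{aⱼbⱼ}] ∧ …` (omitting
the i-th and j-th factors), written in the lexicographically sorted basis.
For lexicographically sorted wedges the only nonzero brackets come from pairs
`a = (x,y)`, `b = (y,z)`, producing `±e_{(x,z)}`. -/
noncomputable def dAux {n : ℕ} (k : ℤ) (M : Finset (P n)) : C n k :=
  ∑ a ∈ M, ∑ b ∈ M,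
    if hab : a.1.2 = b.1.1 then
      (let c : P n := ⟨(a.1.1, b.1.2), lt_trans a.2 (by rw [hab]; exact b.2)⟩
       let M' : Finset (P n) := insert c ((M.erase a).erase b)
       if h' : (M'.card : ℤ) = k then
         ((-1 : ℤ) ^ (pos M a + pos M b + pos M' c)) • Finsupp.single (⟨M', h'⟩ : B n k) 1
       else 0)
    else 0

/-- The Chevalley-Eilenberg boundary map in degree `k+1`. -/
noncomputable def d (n : ℕ) (k : ℤ) : C n (k + 1) →ₗ[ℤ] C n k :=
  Finsupp.lsum ℤ fun M => LinearMap.toSpanSingleton ℤ (C n k) (dAux k M.1)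

/-- Degree-cast isomorphism. -/
noncomputable def castC (n : ℕ) {k l : ℤ} (h : k = l) : C n k ≃ₗ[ℤ] C n l :=
  Finsupp.domLCongr (Equiv.subtypeEquivRight fun _ => by rw [h])

/-- The boundary map out of degree `k`. -/
noncomputable def dFrom (n : ℕ) (k : ℤ) : C n k →ₗ[ℤ] C n (k - 1) :=
  (d n (k - 1)).comp (castC n (by ring : k = k - 1 + 1)).toLinearMap

/-- Cycles of `Λ^* nil_n` in degree `k`. -/
noncomputable def Zfull (n : ℕ) (k : ℤ) : Submodule ℤ (C n k) := LinearMap.ker (dFrom n k)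

noncomputable def HnilSub (n : ℕ) (k : ℤ) : Submodule ℤ (Zfull n k) :=
  Submodule.comap (Zfull n k).subtype (LinearMap.range (d n k) ⊓ Zfull n k)

/-- `H_k(nil_n; ℤ)`: the `k`-th integral homology of the Chevalley-Eilenberg complex
of the Lie ring of strictly upper triangular `n × n` integer matrices. -/
noncomputable def Hnil (n : ℕ) (k : ℤ) : Type := Zfull n k ⧸ HnilSub n k

noncomputable instance (n : ℕ) (k : ℤ) : AddCommGroup (Hnil n k) :=
  inferInstanceAs (AddCommGroup (Zfull n k ⧸ HnilSub n k))

noncomputable instance (n : ℕ) (k : ℤ) : Module ℤ (Hnil n k) :=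
  inferInstanceAs (Module ℤ (Zfull n k ⧸ HnilSub n k))

/-- The modified weight of a basis wedge `e_M` (indices of `Fin n` are 0-based, so the
`i`-th weight of the paper, `1 ≤ i ≤ n`, is `wt M ⟨i-1,_⟩`):
`w_i(e_M) = i - #{x : (x,i) ∈ M} + #{y : (i,y) ∈ M}`. -/
def wt {n : ℕ} (M : Finset (P n)) : Fin n → ℤ := fun i =>
  ((i.1 : ℤ) + 1) - (M.filter fun p => p.1.2 = i).card + (M.filter fun p => p.1.1 = i).card

/-- Basis wedges of degree `k` and modified weight `w`. -/
abbrev Bw (n : ℕ) (k : ℤ) (w : Fin n → ℤ) : Type :=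
  {M : Finset (P n) // (M.card : ℤ) = k ∧ wt M = w}

/-- Degree `k` part of the weight summand `⟦w⟧` of `Λ^* nil_n`. -/
abbrev Cw (n : ℕ) (k : ℤ) (w : Fin n → ℤ) : Type := Bw n k w →₀ ℤ

/-- Inclusion of the weight summand. -/
noncomputable def inclW (n : ℕ) (k : ℤ) (w : Fin n → ℤ) : Cw n k w →ₗ[ℤ] C n k :=
  Finsupp.lmapDomain ℤ ℤ fun M => (⟨M.1, M.2.1⟩ : B n k)

/-- Projection onto the weight summand. -/
noncomputable def projW (n : ℕ) (k : ℤ) (w : Fin n → ℤ) : C n k →ₗ[ℤ] Cw n k w :=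
  Finsupp.lsum ℤ fun M =>
    if h : wt M.1 = w then
      LinearMap.toSpanSingleton ℤ (Cw n k w) (Finsupp.single (⟨M.1, M.2, h⟩ : Bw n k w) 1)
    else 0

/-- The boundary of the weight summand `⟦w⟧` (the boundary preserves weights, so this
is the restriction of the Chevalley-Eilenberg boundary). -/
noncomputable def dW (n : ℕ) (k : ℤ) (w : Fin n → ℤ) : Cw n (k + 1) w →ₗ[ℤ] Cw n k w :=
  (projW n k w) ∘ₗ (d n k) ∘ₗ (inclW n (k + 1) w)

noncomputable def castCw (n : ℕ) (w : Fin n → ℤ) {k l : ℤ} (h : k = l) :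
    Cw n k w ≃ₗ[ℤ] Cw n l w :=
  Finsupp.domLCongr (Equiv.subtypeEquivRight fun _ => by rw [h])

noncomputable def dFromW (n : ℕ) (k : ℤ) (w : Fin n → ℤ) : Cw n k w →ₗ[ℤ] Cw n (k - 1) w :=
  (dW n (k - 1) w).comp (castCw n w (by ring : k = k - 1 + 1)).toLinearMap

noncomputable def ZW (n : ℕ) (k : ℤ) (w : Fin n → ℤ) : Submodule ℤ (Cw n k w) :=
  LinearMap.ker (dFromW n k w)

noncomputable def HwSub (n : ℕ) (k : ℤ) (w : Fin n → ℤ) : Submodule ℤ (ZW n k w) :=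
  Submodule.comap (ZW n k w).subtype (LinearMap.range (dW n k w) ⊓ ZW n k w)

/-- `H_k⟦w⟧`: the `k`-th homology of the weight summand `⟦w⟧` of `Λ^* nil_n`. -/
noncomputable def Hw (n : ℕ) (k : ℤ) (w : Fin n → ℤ) : Type := ZW n k w ⧸ HwSub n k w

noncomputable instance (n : ℕ) (k : ℤ) (w : Fin n → ℤ) : AddCommGroup (Hw n k w) :=
  inferInstanceAs (AddCommGroup (ZW n k w ⧸ HwSub n k w))

noncomputable instance (n : ℕ) (k : ℤ) (w : Fin n → ℤ) : Module ℤ (Hw n k w) :=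
  inferInstanceAs (Module ℤ (ZW n k w ⧸ HwSub n k w))

/-- `w ∈ 𝒮_n`: all entries lie in `{1,…,n}` and they add up to `binom (n+1) 2`. -/
def Sn (n : ℕ) (w : Fin n → ℤ) : Prop :=
  (∀ i, 1 ≤ w i ∧ w i ≤ (n : ℤ)) ∧ 2 * ∑ i, w i = (n : ℤ) * ((n : ℤ) + 1)

/-- Number of inversions of a permutation of `Fin n`. -/
def invCount (n : ℕ) (π : Equiv.Perm (Fin n)) : ℕ :=
  (Finset.univ.filter fun p : Fin n × Fin n => p.1 < p.2 ∧ π p.2 < π p.1).card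

/-- The weight sequence `(π(1), …, π(n))` attached to a permutation (1-based values). -/
def permWt (n : ℕ) (π : Equiv.Perm (Fin n)) : Fin n → ℤ := fun i => ((π i).1 : ℤ) + 1

/-- The set of inversions of a permutation, as a set of index pairs. -/
def invFinset {n : ℕ} (π : Equiv.Perm (Fin n)) : Finset (P n) :=
  Finset.univ.filter fun p => π p.1.2 < π p.1.1

/-- Index reversal `i ↦ n+1-i` (0-based: `i ↦ n-1-i`). -/
def rev {n : ℕ} (i : Fin n) : Fin n := ⟨n - 1 - i.1, by have := i.isLt; omega⟩


/-- `(2, w₂, w₃, …, w_n) ↦ (2, w₃, …, w_n, w₂)`. -/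
def rot2 {n : ℕ} (hn : 2 ≤ n) (w : Fin n → ℤ) : Fin n → ℤ := fun i =>
  if i.1 = 0 then 2
  else if h2 : i.1 = n - 1 then w ⟨1, by omega⟩
  else w ⟨i.1 + 1, by have := i.isLt; omega⟩

/-- `(2, w₂, w₃, …, w_n) ↦ (w₂, w₃-1, …, w_n-1)`. -/
def vshift {n : ℕ} (hn : 2 ≤ n) (w : Fin n → ℤ) : Fin (n - 1) → ℤ := fun i =>
  if i.1 = 0 then w ⟨1, by omega⟩
  else w ⟨i.1 + 1, by have := i.isLt; omega⟩ - 1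

section Fock

variable {ι : Type*}

/-- The exterior algebra on `ι`, as functions of the set of occupied modes. -/
abbrev Fock (ι : Type*) : Type _ := Finset ι → ℤ

/-- The sign picked up when moving `a` past `b` in the order given by `r`. -/
def sgn (r : ι → ℕ) (b a : ι) : ℤ := if r b < r a then -1 else 1

/-- The sign picked up when moving `a` from the front of the wedge `M` to its sorted position. -/
def jw (r : ι → ℕ) (a : ι) (M : Finset ι) : ℤ := ∏ b ∈ M, sgn r b a

@[simp] theorem sgn_self (r : ι → ℕ) (a : ι) : sgn r a a = 1 := by simp [sgn]

@[simp] theorem sgn_mul_self (r : ι → ℕ) (a b : ι) : sgn r a b * sgn r a b = 1 := by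
  unfold sgn; split_ifs <;> rfl

theorem sgn_swap {r : ι → ℕ} (hr : Function.Injective r) {a b : ι} (h : a ≠ b) :
    sgn r a b = -sgn r b a := by
  have := hr.ne h
  unfold sgn
  split_ifs <;> omega

@[simp] theorem jw_mul_self (r : ι → ℕ) (a : ι) (M : Finset ι) : jw r a M * jw r a M = 1 := by
  simp [jw, ← Finset.prod_mul_distrib]

/-- Vectors supported on wedges satisfying `s`. -/
def Supp (s : Finset ι → Prop) : Submodule ℤ (Fock ι) where
  carrier := {x | ∀ M, x M ≠ 0 → s M}
  add_mem' {x y} hx hy M h := by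
    by_cases h' : x M = 0
    · exact hy M (by simpa [h'] using h)
    · exact hx M h'
  zero_mem' M h := absurd rfl h
  smul_mem' t x hx M h := hx M (by simp at h; exact h.2)

theorem mem_Supp {s : Finset ι → Prop} {x : Fock ι} : x ∈ Supp s ↔ ∀ M, x M ≠ 0 → s M := Iff.rfl

/-- Vectors of degree `v` for the grading in which `e_p` has degree `γ p`. -/
def Homog {Γ : Type*} [AddCommGroup Γ] (γ : ι → Γ) (v : Γ) : Submodule ℤ (Fock ι) :=
  Supp fun M => ∑ p ∈ M, γ p = v

variable {κ : Type*}

section Restrict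

variable {r : ι → ℕ} {r' : κ → ℕ} (j : ι ↪ κ)

/-- Pullback of coefficients along an embedding of modes. -/
def restr : Fock κ →ₗ[ℤ] Fock ι where
  toFun x M := x (M.map j)
  map_add' _ _ := rfl
  map_smul' _ _ := rfl

theorem restr_apply (x : Fock κ) (M : Finset ι) : restr j x M = x (M.map j) := rfl

theorem jw_map (hj : ∀ p q, r' (j p) < r' (j q) ↔ r p < r q) (a : ι) (M : Finset ι) :
    jw r' (j a) (M.map j) = jw r a M := by
  simp [jw, sgn, hj]

end Restrict

section Sign

variable (r : ι → ℕ) (r' : κ → ℕ) (φ : ι ≃ κ) (F : Finset ι)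

/-- The relative sign of the relabelled wedge. -/
def flipSign (M : Finset ι) : ℤ :=
  (∏ m ∈ M, ∏ f ∈ F, sgn r' (φ f) (φ m)) *
    ∏ p ∈ M, ∏ q ∈ M, if r p < r q then sgn r p q * sgn r' (φ p) (φ q) else 1

theorem flipSign_mul_self (M : Finset ι) : flipSign r r' φ F M * flipSign r r' φ F M = 1 := by
  have h : ∀ a b : ℤ, a * b * (a * b) = (a * a) * (b * b) := fun a b => by ring
  rw [flipSign, h]
  simp only [← Finset.prod_mul_distrib]
  have h' : ∀ p q : ι, (if r p < r q then sgn r p q * sgn r' (φ p) (φ q) else 1) *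
      (if r p < r q then sgn r p q * sgn r' (φ p) (φ q) else 1) = 1 := by
    intro p q
    split_ifs
    · rw [h]; simp
    · rfl
  simp [h']

end Sign

variable [DecidableEq ι]

/-- Exterior multiplication by `e_a`. -/
def cre (r : ι → ℕ) (a : ι) : Module.End ℤ (Fock ι) where
  toFun x M := if a ∈ M then jw r a M * x (M.erase a) else 0
  map_add' x y := by ext M; simp only [Pi.add_apply]; split_ifs <;> ring
  map_smul' t x := by
    ext M
    simp only [Pi.smul_apply, smul_eq_mul, RingHom.id_apply]
    split_ifs <;> ring

/-- Contraction by the dual of `e_a`. -/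
def ann (r : ι → ℕ) (a : ι) : Module.End ℤ (Fock ι) where
  toFun x M := if a ∈ M then 0 else jw r a M * x (insert a M)
  map_add' x y := by ext M; simp only [Pi.add_apply]; split_ifs <;> ring
  map_smul' t x := by
    ext M
    simp only [Pi.smul_apply, smul_eq_mul, RingHom.id_apply]
    split_ifs <;> ring

theorem cre_apply (r : ι → ℕ) (a : ι) (x : Fock ι) (M : Finset ι) :
    cre r a x M = if a ∈ M then jw r a M * x (M.erase a) else 0 := rfl

theorem ann_apply (r : ι → ℕ) (a : ι) (x : Fock ι) (M : Finset ι) :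
    ann r a x M = if a ∈ M then 0 else jw r a M * x (insert a M) := rfl

theorem jw_insert (r : ι → ℕ) (a : ι) {b : ι} {M : Finset ι} (h : b ∉ M) :
    jw r a (insert b M) = sgn r b a * jw r a M := by
  simp [jw, Finset.prod_insert h]

theorem jw_insert_self (r : ι → ℕ) (a : ι) (M : Finset ι) :
    jw r a (insert a M) = jw r a M := by
  by_cases h : a ∈ M
  · rw [Finset.insert_eq_of_mem h]
  · rw [jw_insert r a h]; simp

theorem jw_erase (r : ι → ℕ) (a : ι) {b : ι} {M : Finset ι} (h : b ∈ M) :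
    jw r a (M.erase b) = sgn r b a * jw r a M := by
  conv_rhs => rw [← Finset.insert_erase h, jw_insert r a (Finset.notMem_erase b M), ← mul_assoc]
  simp

theorem ann_mul_ann {r : ι → ℕ} (hr : Function.Injective r) (a b : ι) :
    ann r a * ann r b = -(ann r b * ann r a) := by
  refine LinearMap.ext fun x => funext fun M => ?_
  simp only [Module.End.mul_apply, LinearMap.neg_apply, Pi.neg_apply, ann_apply, Finset.mem_insert]
  by_cases hab : a = b
  · subst hab; simp
  by_cases ha : a ∈ M
  · simp [ha]
  by_cases hb : b ∈ M
  · simp [hb]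
  rw [if_neg ha, if_neg hb, if_neg (by tauto), if_neg (by tauto), jw_insert r b ha,
    jw_insert r a hb, sgn_swap hr hab, Finset.insert_comm]
  ring

theorem cre_mul_cre {r : ι → ℕ} (hr : Function.Injective r) (a b : ι) :
    cre r a * cre r b = -(cre r b * cre r a) := by
  refine LinearMap.ext fun x => funext fun M => ?_
  simp only [Module.End.mul_apply, LinearMap.neg_apply, Pi.neg_apply, cre_apply, Finset.mem_erase]
  by_cases hab : a = b
  · subst hab; simp
  by_cases ha : a ∈ M
  swap
  · simp [ha]
  by_cases hb : b ∈ M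
  swap
  · simp [hb]
  rw [if_pos ha, if_pos hb, if_pos (by tauto), if_pos (by tauto), jw_erase r b ha,
    jw_erase r a hb, sgn_swap hr hab, Finset.erase_right_comm]
  ring

theorem ann_mul_cre {r : ι → ℕ} (hr : Function.Injective r) (a b : ι) :
    ann r a * cre r b = (if a = b then 1 else 0) - cre r b * ann r a := by
  refine LinearMap.ext fun x => funext fun M => ?_
  by_cases hab : a = b
  · subst hab
    by_cases ha : a ∈ M
    · simp [cre_apply, ann_apply, ha, jw_erase, ← mul_assoc]
    · simp [cre_apply, ann_apply, ha, jw_insert, ← mul_assoc]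
  · simp only [Module.End.mul_apply, LinearMap.sub_apply, Pi.sub_apply, cre_apply, ann_apply,
      Finset.mem_erase, if_neg hab, Finset.mem_insert, LinearMap.zero_apply, Pi.zero_apply]
    by_cases ha : a ∈ M
    · simp [ha, hab]
    by_cases hb : b ∈ M
    swap
    · simp [hb, Ne.symm hab]
    rw [if_neg ha, if_pos hb, if_pos (by tauto), if_neg (by tauto), jw_insert r b ha,
      jw_erase r a hb, sgn_swap hr hab, Finset.erase_insert_of_ne hab]
    ring

theorem cre_homog {Γ : Type*} [AddCommGroup Γ] {γ : ι → Γ} {v : Γ} (r : ι → ℕ) (a : ι)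
    {x : Fock ι} (hx : x ∈ Homog γ v) : cre r a x ∈ Homog γ (v + γ a) := by
  intro M h
  rw [cre_apply] at h
  split_ifs at h with ha
  · rw [← hx _ (right_ne_zero_of_mul h), Finset.sum_erase_add _ _ ha]
  · exact absurd rfl h

theorem ann_homog {Γ : Type*} [AddCommGroup Γ] {γ : ι → Γ} {v : Γ} (r : ι → ℕ) (a : ι)
    {x : Fock ι} (hx : x ∈ Homog γ v) : ann r a x ∈ Homog γ (v - γ a) := by
  intro M h
  rw [ann_apply] at h
  split_ifs at h with ha
  · exact absurd rfl h
  · rw [← hx _ (right_ne_zero_of_mul h), Finset.sum_insert ha]; abel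

section ParticleHole

variable (r : ι → ℕ) (r' : κ → ℕ) (φ : ι ≃ κ) (F : Finset ι)

/-- Relabel modes along `φ` and exchange occupied and empty modes in `F`. -/
def flip : Finset ι ≃ Finset κ where
  toFun M := (symmDiff M F).map φ.toEmbedding
  invFun N := symmDiff (N.map φ.symm.toEmbedding) F
  left_inv M := by
    ext p; simp [Finset.mem_symmDiff]; tauto
  right_inv N := by
    ext p; simp

theorem jw_flip (a : ι) (M : Finset ι) :
    jw r' (φ a) (flip φ F M) = (∏ m ∈ M, sgn r' (φ m) (φ a)) * ∏ m ∈ F, sgn r' (φ m) (φ a) := by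
  simp only [jw, flip, Equiv.coe_fn_mk, Finset.prod_map, Equiv.coe_toEmbedding]
  have hM := Finset.prod_union (f := fun m => sgn r' (φ m) (φ a)) (Finset.disjoint_sdiff_inter M F)
  have hF := Finset.prod_union (f := fun m => sgn r' (φ m) (φ a)) (Finset.disjoint_sdiff_inter F M)
  rw [Finset.sdiff_union_inter] at hM hF
  rw [hM, hF, Finset.inter_comm F M, show symmDiff M F = (M \ F) ∪ (F \ M) from rfl,
    Finset.prod_union (by rw [Finset.disjoint_left]; simp; tauto)]
  have h : (∏ m ∈ M ∩ F, sgn r' (φ m) (φ a)) * (∏ m ∈ M ∩ F, sgn r' (φ m) (φ a)) = 1 := by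
    simp [← Finset.prod_mul_distrib]
  linear_combination (-(∏ m ∈ M \ F, sgn r' (φ m) (φ a)) * ∏ m ∈ F \ M, sgn r' (φ m) (φ a)) * h

theorem flipSign_insert (hr : Function.Injective r) (hr' : Function.Injective r') {a : ι}
    {M : Finset ι} (ha : a ∉ M) :
    flipSign r r' φ F (insert a M) =
      flipSign r r' φ F M * jw r a M * jw r' (φ a) (flip φ F M) := by
  rw [jw_flip]
  simp only [flipSign, Finset.prod_insert ha, lt_irrefl, if_false, one_mul, jw,
    Finset.prod_mul_distrib]
  have h : (∏ q ∈ M, if r a < r q then sgn r a q * sgn r' (φ a) (φ q) else 1) *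
      (∏ p ∈ M, if r p < r a then sgn r p a * sgn r' (φ p) (φ a) else 1) =
      (∏ p ∈ M, sgn r p a) * ∏ p ∈ M, sgn r' (φ p) (φ a) := by
    simp only [← Finset.prod_mul_distrib]
    refine Finset.prod_congr rfl fun m hm => ?_
    have hne : a ≠ m := fun h => ha (h ▸ hm)
    have := hr.ne hne
    rw [sgn_swap hr hne, sgn_swap hr' (φ.injective.ne hne)]
    rcases lt_or_gt_of_ne this with h | h
    · rw [if_pos h, if_neg h.not_gt]; ring
    · rw [if_pos h, if_neg h.not_gt]; ring
  linear_combination (∏ f ∈ F, sgn r' (φ f) (φ a)) * (∏ m ∈ M, ∏ f ∈ F, sgn r' (φ f) (φ m)) *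
    (∏ p ∈ M, ∏ q ∈ M, if r p < r q then sgn r p q * sgn r' (φ p) (φ q) else 1) * h

/-- The linear isomorphism induced by relabelling modes along `φ` and exchanging occupied and
empty modes in `F`. -/
def unflip : Fock κ ≃ₗ[ℤ] Fock ι where
  toFun x M := flipSign r r' φ F M * x (flip φ F M)
  invFun y N := flipSign r r' φ F ((flip φ F).symm N) * y ((flip φ F).symm N)
  map_add' x y := by ext M; simp [mul_add]
  map_smul' t x := by ext M; simp; ring
  left_inv x := by ext N; simp [← mul_assoc, flipSign_mul_self]
  right_inv x := by ext N; simp [← mul_assoc, flipSign_mul_self]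

theorem unflip_apply (x : Fock κ) (M : Finset ι) :
    unflip r r' φ F x M = flipSign r r' φ F M * x (flip φ F M) := rfl

variable {r r' F}

theorem mem_flip {a : ι} {M : Finset ι} :
    φ a ∈ flip φ F M ↔ (a ∈ M ∧ a ∉ F) ∨ (a ∈ F ∧ a ∉ M) := by
  simp [flip, Finset.mem_symmDiff]

theorem flipSign_insert_mul (hr : Function.Injective r) (hr' : Function.Injective r') {a : ι}
    {M : Finset ι} (ha : a ∉ M) :
    jw r a M * flipSign r r' φ F (insert a M) =
      flipSign r r' φ F M * jw r' (φ a) (flip φ F M) := by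
  rw [flipSign_insert r r' φ F hr hr' ha]
  linear_combination (flipSign r r' φ F M * jw r' (φ a) (flip φ F M)) * jw_mul_self r a M

theorem flipSign_erase_mul (hr : Function.Injective r) (hr' : Function.Injective r') {a : ι}
    {M : Finset ι} (ha : a ∈ M) :
    jw r a M * flipSign r r' φ F (M.erase a) =
      flipSign r r' φ F M * jw r' (φ a) (flip φ F M) := by
  have h := flipSign_insert_mul (r := r) (r' := r') (F := F) φ hr hr' (Finset.notMem_erase a M)
  rw [Finset.insert_erase ha] at h
  have h1 : jw r a (M.erase a) = jw r a M := by rw [jw_erase r a ha]; simp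
  have h2 : jw r' (φ a) (flip φ F (M.erase a)) = jw r' (φ a) (flip φ F M) := by
    rw [jw_flip, jw_flip, ← Finset.mul_prod_erase M _ ha]; simp
  rw [h1, h2] at h
  linear_combination (-jw r a M * jw r' (φ a) (flip φ F M)) * h +
    (flipSign r r' φ F M * jw r' (φ a) (flip φ F M)) * jw_mul_self r a M -
    (jw r a M * flipSign r r' φ F (M.erase a)) * jw_mul_self r' (φ a) (flip φ F M)

theorem sum_flip {Γ : Type*} [AddCommGroup Γ] (γ : κ → Γ) (M : Finset ι) :
    ∑ p ∈ flip φ F M, γ p =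
      ∑ p ∈ M, (if p ∈ F then -γ (φ p) else γ (φ p)) + ∑ p ∈ F, γ (φ p) := by
  simp only [flip, Equiv.coe_fn_mk, Finset.sum_map, Equiv.coe_toEmbedding, Finset.sum_ite,
    Finset.sum_neg_distrib, Finset.filter_mem_eq_inter, Finset.filter_notMem_eq_sdiff]
  have hF := Finset.sum_union (f := fun m => γ (φ m)) (Finset.disjoint_sdiff_inter F M)
  rw [Finset.sdiff_union_inter] at hF
  rw [hF, Finset.inter_comm F M, show symmDiff M F = (M \ F) ∪ (F \ M) from rfl,
    Finset.sum_union (by rw [Finset.disjoint_left]; simp; tauto)]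
  abel

variable [DecidableEq κ]

theorem flip_insert {a : ι} {M : Finset ι} (haF : a ∉ F) :
    flip φ F (insert a M) = insert (φ a) (flip φ F M) := by
  ext p
  obtain ⟨p, rfl⟩ := φ.surjective p
  simp only [mem_flip, Finset.mem_insert, EmbeddingLike.apply_eq_iff_eq]
  grind

theorem flip_insert_of_mem {a : ι} {M : Finset ι} (haF : a ∈ F) :
    flip φ F (insert a M) = (flip φ F M).erase (φ a) := by
  ext p
  obtain ⟨p, rfl⟩ := φ.surjective p
  simp only [mem_flip, Finset.mem_insert, Finset.mem_erase, ne_eq, EmbeddingLike.apply_eq_iff_eq]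
  grind

theorem flip_erase {a : ι} {M : Finset ι} (haF : a ∉ F) :
    flip φ F (M.erase a) = (flip φ F M).erase (φ a) := by
  ext p
  obtain ⟨p, rfl⟩ := φ.surjective p
  simp only [mem_flip, Finset.mem_erase, ne_eq, EmbeddingLike.apply_eq_iff_eq]
  grind

theorem flip_erase_of_mem {a : ι} {M : Finset ι} (haF : a ∈ F) :
    flip φ F (M.erase a) = insert (φ a) (flip φ F M) := by
  ext p
  obtain ⟨p, rfl⟩ := φ.surjective p
  simp only [mem_flip, Finset.mem_erase, Finset.mem_insert, ne_eq, EmbeddingLike.apply_eq_iff_eq]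
  grind

theorem unflip_cre (hr : Function.Injective r) (hr' : Function.Injective r') {a : ι}
    (ha : a ∉ F) (x : Fock κ) :
    unflip r r' φ F (cre r' (φ a) x) = cre r a (unflip r r' φ F x) := by
  ext M
  simp only [unflip_apply, cre_apply, mem_flip]
  by_cases h : a ∈ M
  · rw [if_pos (by tauto), if_pos h, flip_erase φ ha, ← mul_assoc, ← mul_assoc,
      flipSign_erase_mul φ hr hr' h]
  · rw [if_neg (by tauto), if_neg h, mul_zero]

theorem unflip_ann (hr : Function.Injective r) (hr' : Function.Injective r') {a : ι}
    (ha : a ∉ F) (x : Fock κ) :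
    unflip r r' φ F (ann r' (φ a) x) = ann r a (unflip r r' φ F x) := by
  ext M
  simp only [unflip_apply, ann_apply, mem_flip]
  by_cases h : a ∈ M
  · rw [if_pos (by tauto), if_pos h, mul_zero]
  · rw [if_neg (by tauto), if_neg h, flip_insert φ ha, ← mul_assoc, ← mul_assoc,
      flipSign_insert_mul φ hr hr' h]

theorem unflip_cre_of_mem (hr : Function.Injective r) (hr' : Function.Injective r') {a : ι}
    (ha : a ∈ F) (x : Fock κ) :
    unflip r r' φ F (cre r' (φ a) x) = ann r a (unflip r r' φ F x) := by
  ext M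
  simp only [unflip_apply, cre_apply, ann_apply, mem_flip]
  by_cases h : a ∈ M
  · rw [if_neg (by tauto), if_pos h, mul_zero]
  · rw [if_pos (by tauto), if_neg h, flip_insert_of_mem φ ha, ← mul_assoc, ← mul_assoc,
      flipSign_insert_mul φ hr hr' h]

theorem unflip_ann_of_mem (hr : Function.Injective r) (hr' : Function.Injective r') {a : ι}
    (ha : a ∈ F) (x : Fock κ) :
    unflip r r' φ F (ann r' (φ a) x) = cre r a (unflip r r' φ F x) := by
  ext M
  simp only [unflip_apply, cre_apply, ann_apply, mem_flip]
  by_cases h : a ∈ M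
  · rw [if_neg (by tauto), if_pos h, flip_erase_of_mem φ ha, ← mul_assoc, ← mul_assoc,
      flipSign_erase_mul φ hr hr' h]
  · rw [if_pos (by tauto), if_neg h, mul_zero]

end ParticleHole

section Restrict

theorem restr_cre_of_notMem (r : ι → ℕ) (j : κ ↪ ι) {b : ι} (hb : b ∉ Set.range j) (x : Fock ι) :
    restr j (cre r b x) = 0 := by
  ext M
  rw [restr_apply, cre_apply, if_neg]
  · rfl
  · rw [Finset.mem_map]; rintro ⟨a, -, rfl⟩; exact hb ⟨a, rfl⟩

variable [DecidableEq κ] {r : ι → ℕ} {r' : κ → ℕ} (j : ι ↪ κ)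

theorem restr_cre (hj : ∀ p q, r' (j p) < r' (j q) ↔ r p < r q) (a : ι) (x : Fock κ) :
    restr j (cre r' (j a) x) = cre r a (restr j x) := by
  ext M
  simp [restr_apply, cre_apply, jw_map j hj, Finset.map_erase]

theorem restr_ann (hj : ∀ p q, r' (j p) < r' (j q) ↔ r p < r q) (a : ι) (x : Fock κ) :
    restr j (ann r' (j a) x) = ann r a (restr j x) := by
  ext M
  simp [restr_apply, ann_apply, jw_map j hj, Finset.map_insert]

end Restrict

end Fock

section Boundary

variable {n : ℕ}

theorem key_lt_key {p q : P n} :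
    key p < key q ↔ p.1.1 < q.1.1 ∨ p.1.1 = q.1.1 ∧ p.1.2 < q.1.2 := by
  obtain ⟨⟨⟨a, ha⟩, ⟨b, hb⟩⟩, hp⟩ := p
  obtain ⟨⟨⟨a', ha'⟩, ⟨b', hb'⟩⟩, hq⟩ := q
  simp only [key, Fin.mk_lt_mk, Fin.mk.injEq]
  rcases lt_trichotomy a a' with h | h | h
  · have : (a + 1) * n ≤ a' * n := Nat.mul_le_mul_right n h
    rw [add_mul] at this
    constructor
    · tauto
    · intro; omega
  · subst h; simp
  · have : (a' + 1) * n ≤ a * n := Nat.mul_le_mul_right n h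
    rw [add_mul] at this
    constructor
    · intro; omega
    · rintro (h' | h') <;> omega

theorem key_injective : Function.Injective (key (n := n)) := by
  intro p q h
  have h1 := mt key_lt_key.2 h.not_lt
  have h2 := mt key_lt_key.2 h.symm.not_lt
  refine Subtype.ext (Prod.ext ?_ ?_) <;> grind

theorem neg_one_pow_pos (M : Finset (P n)) (a : P n) : (-1 : ℤ) ^ pos M a = jw key a M := by
  simp [pos, jw, sgn, Finset.prod_ite]

/-- Exterior multiplication by `e_{xz}`, zero unless `x < z`. -/
def cr (x z : Fin n) : Module.End ℤ (Fock (P n)) :=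
  if h : x < z then cre key ⟨(x, z), h⟩ else 0

/-- Contraction by the dual of `e_{xz}`, zero unless `x < z`. -/
def an (x z : Fin n) : Module.End ℤ (Fock (P n)) :=
  if h : x < z then ann key ⟨(x, z), h⟩ else 0

theorem cr_of_lt {x z : Fin n} (h : x < z) : cr x z = cre key ⟨(x, z), h⟩ := dif_pos h

theorem an_of_lt {x z : Fin n} (h : x < z) : an x z = ann key ⟨(x, z), h⟩ := dif_pos h

theorem cr_of_not_lt {x z : Fin n} (h : ¬x < z) : cr x z = 0 := dif_neg h

theorem an_of_not_lt {x z : Fin n} (h : ¬x < z) : an x z = 0 := dif_neg h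

theorem an_mul_an (x y z t : Fin n) : an x y * an z t = -(an z t * an x y) := by
  unfold an
  split_ifs
  · exact ann_mul_ann key_injective _ _
  all_goals simp

theorem cr_mul_cr (x y z t : Fin n) : cr x y * cr z t = -(cr z t * cr x y) := by
  unfold cr
  split_ifs
  · exact cre_mul_cre key_injective _ _
  all_goals simp

theorem an_mul_cr (x y z t : Fin n) :
    an x y * cr z t = (if x = z ∧ y = t ∧ x < y then 1 else 0) - cr z t * an x y := by
  by_cases h : x < y
  · by_cases h' : z < t
    · rw [an_of_lt h, cr_of_lt h', ann_mul_cre key_injective]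
      simp [Subtype.ext_iff, Prod.ext_iff, h]
    · rw [cr_of_not_lt h', if_neg (by grind)]; simp
  · rw [an_of_not_lt h, if_neg (by tauto)]; simp

/-- The Chevalley-Eilenberg boundary on the whole exterior algebra of `nil_n`. -/
def bd (n : ℕ) : Module.End ℤ (Fock (P n)) :=
  ∑ x, ∑ y, ∑ z, cr x z * (an x y * an y z)

theorem bd_mul_an_add (a b : Fin n) :
    bd n * an a b + an a b * bd n = ∑ y, an a y * an y b := by
  have h : ∀ x y z : Fin n, cr x z * (an x y * an y z) * an a b +
      an a b * (cr x z * (an x y * an y z)) =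
      if a = x then if b = z then an x y * an y z else 0 else 0 := by
    intro x y z
    have h1 : an x y * an y z * an a b = an a b * (an x y * an y z) := by
      rw [mul_assoc, an_mul_an y z, mul_neg, ← mul_assoc, an_mul_an x y]; simp [mul_assoc]
    rw [mul_assoc (cr x z), h1, ← mul_assoc (an a b) (cr x z), an_mul_cr, sub_mul, ← mul_assoc,
      ← mul_assoc, ← mul_assoc, add_sub_cancel]
    by_cases hxz : x < y ∧ y < z
    · have := hxz.1.trans hxz.2
      grind
    · have : an x y * an y z = 0 := by
        rcases not_and_or.1 hxz with h | h
        · rw [an_of_not_lt h, zero_mul]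
        · rw [an_of_not_lt h, mul_zero]
      simp [this]
  simp only [bd, Finset.sum_mul, Finset.mul_sum, ← Finset.sum_add_distrib, h]
  rw [Finset.sum_eq_single a]
  · simp
  · intro x _ hx; simp [Ne.symm hx]
  · simp

theorem bd_mul_bd_mul_an (a b : Fin n) : bd n * bd n * an a b = an a b * (bd n * bd n) := by
  have key_id : ∀ D A B J K : Module.End ℤ (Fock (P n)), D * A + A * D = J → D * B + B * D = K →
      D * (A * B) - A * B * D = J * B - A * K := by
    rintro D A B _ _ rfl rfl; noncomm_ring
  have h : bd n * (∑ y, an a y * an y b) - (∑ y, an a y * an y b) * bd n = 0 := by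
    simp only [Finset.mul_sum, Finset.sum_mul, ← Finset.sum_sub_distrib]
    simp only [key_id _ _ _ _ _ (bd_mul_an_add _ _) (bd_mul_an_add _ _)]
    simp only [Finset.mul_sum, Finset.sum_mul, Finset.sum_sub_distrib]
    rw [sub_eq_zero, Finset.sum_comm]
    simp only [mul_assoc]
  rw [← bd_mul_an_add] at h
  rw [← sub_eq_zero, ← h]
  noncomm_ring

theorem bd_apply_empty (x : Fock (P n)) : bd n x ∅ = 0 := by
  have h : ∀ (a b : Fin n) (y : Fock (P n)), cr a b y ∅ = 0 := by
    intro a b y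
    unfold cr
    split_ifs
    · simp [cre_apply]
    · rfl
  simp [bd, LinearMap.sum_apply, Finset.sum_apply, h]

theorem bd_bd (x : Fock (P n)) : bd n (bd n x) = 0 := by
  suffices h : ∀ (N : Finset (P n)) (x : Fock (P n)), bd n (bd n x) N = 0 from funext fun N => h N x
  intro N
  induction N using Finset.induction_on with
  | empty => exact fun x => bd_apply_empty _
  | insert p N hp ih =>
    intro x
    have h := congrFun (LinearMap.congr_fun (bd_mul_bd_mul_an p.1.1 p.1.2) x) N
    simp only [Module.End.mul_apply, an_of_lt p.2, ann_apply, if_neg hp] at h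
    rw [ih] at h
    have h' := congrArg (jw key p N * ·) h.symm
    simpa [← mul_assoc] using h'

/-- The weight of `e_p`. -/
def wtP (p : P n) (i : Fin n) : ℤ := (if p.1.1 = i then 1 else 0) - if p.1.2 = i then 1 else 0

theorem wt_apply (M : Finset (P n)) (i : Fin n) : wt M i = (i : ℤ) + 1 + ∑ p ∈ M, wtP p i := by
  simp only [wt, wtP, Finset.sum_sub_distrib, Finset.sum_boole]
  ring

/-- The vectors of degree `k` and weight `w`. -/
def Gr (n : ℕ) (k : ℤ) (w : Fin n → ℤ) : Submodule ℤ (Fock (P n)) :=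
  Supp fun M => (M.card : ℤ) = k ∧ wt M = w

theorem Gr_eq_Homog (k : ℤ) (w : Fin n → ℤ) :
    Gr n k w = Homog (fun p => ((1 : ℤ), wtP p)) (k, fun i => w i - ((i : ℤ) + 1)) := by
  have h : ∀ M : Finset (P n), ((M.card : ℤ) = k ∧ wt M = w) ↔
      ∑ p ∈ M, ((1 : ℤ), wtP p) = (k, fun i => w i - ((i : ℤ) + 1)) := by
    intro M
    rw [Prod.ext_iff, Prod.fst_sum, Prod.snd_sum]
    simp only [funext_iff, wt_apply, Finset.sum_apply]
    simp [eq_sub_iff_add_eq']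
  simp only [Gr, Homog, h]

theorem term_mem_Gr (x y z : Fin n) {k : ℤ} {w : Fin n → ℤ} {v : Fock (P n)}
    (hv : v ∈ Gr n (k + 1) w) : (cr x z * (an x y * an y z)) v ∈ Gr n k w := by
  by_cases h : x < y
  · by_cases h' : y < z
    · rw [cr_of_lt (h.trans h'), an_of_lt h, an_of_lt h']
      simp only [Module.End.mul_apply]
      rw [Gr_eq_Homog] at hv ⊢
      have := cre_homog key ⟨(x, z), h.trans h'⟩
        (ann_homog key ⟨(x, y), h⟩ (ann_homog key ⟨(y, z), h'⟩ hv))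
      convert this using 2
      refine Prod.ext (by simp) (funext fun i => ?_)
      simp [wtP]
      ring
    · simp [an_of_not_lt h']
  · simp [an_of_not_lt h]

theorem bd_mem_Gr {k : ℤ} {w : Fin n → ℤ} {v : Fock (P n)}
    (hv : v ∈ Gr n (k + 1) w) : bd n v ∈ Gr n k w := by
  simp only [bd, LinearMap.sum_apply]
  exact sum_mem fun x _ => sum_mem fun y _ => sum_mem fun z _ => term_mem_Gr x y z hv

/-- The basis wedge `e_M`. -/
def wedge (M : Finset (P n)) : Fock (P n) := fun N => if M = N then 1 else 0

/-- Extension by zero of chains of degree `k`. -/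
noncomputable def ofC (n : ℕ) (k : ℤ) : C n k →ₗ[ℤ] Fock (P n) :=
  Finsupp.lsum ℤ fun M => LinearMap.toSpanSingleton ℤ _ (wedge M.1)

/-- Extension by zero of chains of degree `k` and weight `w`. -/
noncomputable def ofCw (n : ℕ) (k : ℤ) (w : Fin n → ℤ) : Cw n k w →ₗ[ℤ] Fock (P n) :=
  Finsupp.lsum ℤ fun M => LinearMap.toSpanSingleton ℤ _ (wedge M.1)

theorem ofC_single (k : ℤ) (M : B n k) (t : ℤ) : ofC n k (Finsupp.single M t) = t • wedge M.1 := by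
  simp [ofC]

theorem ofCw_single (k : ℤ) (w : Fin n → ℤ) (M : Bw n k w) (t : ℤ) :
    ofCw n k w (Finsupp.single M t) = t • wedge M.1 := by
  simp [ofCw]

theorem sum_sum_dite_lt {A : Type*} [AddCommMonoid A] (f : P n → A) :
    (∑ x : Fin n, ∑ y : Fin n, if h : x < y then f ⟨(x, y), h⟩ else 0) = ∑ p, f p := by
  rw [← Fintype.sum_prod_type' (f := fun x y => if h : x < y then f ⟨(x, y), h⟩ else 0),
    ← Finset.sum_filter_add_sum_filter_not _ (fun p : Fin n × Fin n => p.1 < p.2)]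
  rw [Finset.sum_eq_zero (s := Finset.univ.filter fun p : Fin n × Fin n => ¬p.1 < p.2), add_zero]
  · rw [Finset.sum_subtype (p := fun p : Fin n × Fin n => p.1 < p.2) _ (by simp)]
    exact Finset.sum_congr rfl fun p _ => dif_pos p.2
  · intro p hp
    rw [dif_neg]
    simpa using hp

theorem term_wedge {x y z : Fin n} (h : x < y) (h' : y < z) (M : Finset (P n)) :
    (cr x z * (an x y * an y z)) (wedge M) =
      if (⟨(x, y), h⟩ : P n) ∈ M ∧ (⟨(y, z), h'⟩ : P n) ∈ M then
        if (⟨(x, z), h.trans h'⟩ : P n) ∈ M then 0 else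
        ((-1 : ℤ) ^ (pos M ⟨(x, y), h⟩ + pos M ⟨(y, z), h'⟩ +
          pos (insert ⟨(x, z), h.trans h'⟩ ((M.erase ⟨(x, y), h⟩).erase ⟨(y, z), h'⟩))
            ⟨(x, z), h.trans h'⟩)) •
          wedge (insert ⟨(x, z), h.trans h'⟩ ((M.erase ⟨(x, y), h⟩).erase ⟨(y, z), h'⟩))
      else 0 := by
  rw [cr_of_lt (h.trans h'), an_of_lt h, an_of_lt h']
  have hab : (⟨(x, y), h⟩ : P n) ≠ ⟨(y, z), h'⟩ := by
    simp [Subtype.ext_iff, Prod.ext_iff, h.ne]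
  have hac : (⟨(x, z), h.trans h'⟩ : P n) ≠ ⟨(x, y), h⟩ := by
    simp [Subtype.ext_iff, Prod.ext_iff, h'.ne']
  have hbc : (⟨(x, z), h.trans h'⟩ : P n) ≠ ⟨(y, z), h'⟩ := by
    simp [Subtype.ext_iff, Prod.ext_iff, h.ne]
  have hlt : key (⟨(x, y), h⟩ : P n) < key (⟨(y, z), h'⟩ : P n) := key_lt_key.2 (Or.inl h)
  generalize (⟨(x, y), h⟩ : P n) = a at *
  generalize (⟨(y, z), h'⟩ : P n) = b at *
  generalize (⟨(x, z), h.trans h'⟩ : P n) = c at *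
  ext N
  simp only [Module.End.mul_apply, cre_apply, ann_apply, pow_add, neg_one_pow_pos]
  have hsgn : sgn key b a = 1 := if_neg hlt.not_gt
  by_cases hN : c ∈ N ∧ a ∉ N ∧ b ∉ N ∧ insert b (insert a (N.erase c)) = M
  · obtain ⟨hc, ha, hb, rfl⟩ := hN
    have ha' : a ∉ N.erase c := by simp [ha]
    have hb' : b ∉ insert a (N.erase c) := by simp [hb, hab.symm]
    have hc' : c ∉ insert b (insert a (N.erase c)) := by simp [hac, hbc]
    have e : insert c (((insert b (insert a (N.erase c))).erase a).erase b) = N := by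
      ext p; grind
    rw [if_pos hc, if_neg ha', if_neg hb', if_pos (by simp), if_neg hc', e,
      jw_insert_self, jw_insert _ _ ha', jw_insert _ _ hb', jw_insert_self, hsgn]
    simp [wedge, jw_erase key a hc, jw_erase key b hc]
    ring
  · rw [show (if c ∈ N then _ else (0 : ℤ)) = 0 from ?_]
    · split_ifs with h1 h2
      · rfl
      · rw [Pi.smul_apply, wedge, if_neg, smul_zero]
        rintro rfl
        apply hN
        refine ⟨by simp, ?_, ?_, ?_⟩
        · grind
        · grind
        · ext p; grind
      · rfl
    · simp only [wedge]
      grind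

theorem ofC_dAux {k : ℤ} {M : Finset (P n)} (hM : (M.card : ℤ) = k + 1) :
    ofC n k (dAux k M) = bd n (wedge M) := by
  let T : P n → P n → Fock (P n) := fun a b =>
    if a.1.2 = b.1.1 then (cr a.1.1 b.1.2 * (an a.1.1 a.1.2 * an b.1.1 b.1.2)) (wedge M) else 0
  have hbd : bd n (wedge M) = ∑ a, ∑ b, T a b := by
    simp only [bd, LinearMap.sum_apply]
    rw [← sum_sum_dite_lt (fun a => ∑ b, T a b)]
    refine Finset.sum_congr rfl fun x _ => Finset.sum_congr rfl fun y _ => ?_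
    split_ifs with h
    · rw [← sum_sum_dite_lt (T ⟨(x, y), h⟩)]
      symm
      rw [Finset.sum_eq_single y]
      · refine Finset.sum_congr rfl fun z _ => ?_
        split_ifs with h'
        · simp [T]
        · simp [an_of_not_lt h']
      · intro t _ ht
        refine Finset.sum_eq_zero fun z _ => ?_
        simp [T, Ne.symm ht]
      · simp
    · simp [an_of_not_lt h]
  have hT : ∀ a b, ¬(a ∈ M ∧ b ∈ M) → T a b = 0 := by
    rintro ⟨⟨x, y⟩, h⟩ ⟨⟨t, z⟩, h'⟩ hab
    simp only [T]
    split_ifs with e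
    · obtain rfl : y = t := e
      rw [term_wedge h h', if_neg hab]
    · rfl
  rw [hbd, dAux, map_sum]
  have h1 : ∑ a, ∑ b, T a b = ∑ a ∈ M, ∑ b ∈ M, T a b := by
    rw [← Finset.sum_subset (Finset.subset_univ M)]
    · refine Finset.sum_congr rfl fun a _ => ?_
      rw [← Finset.sum_subset (Finset.subset_univ M)]
      exact fun b _ hb => hT a b (by tauto)
    · exact fun a _ ha => Finset.sum_eq_zero fun b _ => hT a b (by tauto)
  rw [h1]
  refine Finset.sum_congr rfl fun a ha => ?_
  rw [map_sum]
  refine Finset.sum_congr rfl fun b hb => ?_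
  obtain ⟨⟨x, y⟩, h⟩ := a
  obtain ⟨⟨t, z⟩, h'⟩ := b
  by_cases e : y = t
  swap
  · simp [T, e]
  subst e
  simp only [T, if_true, dif_pos]
  rw [term_wedge h h', if_pos ⟨ha, hb⟩]
  have hab : (⟨(y, z), h'⟩ : P n) ≠ ⟨(x, y), h⟩ := by
    have := show x < y from h
    simp [Subtype.ext_iff, Prod.ext_iff, this.ne']
  have hcard : ((((M.erase ⟨(x, y), h⟩).erase ⟨(y, z), h'⟩).card : ℤ)) = k - 1 := by
    have h2 : (⟨(y, z), h'⟩ : P n) ∈ M.erase ⟨(x, y), h⟩ := Finset.mem_erase.2 ⟨hab, hb⟩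
    have := Finset.card_erase_add_one ha
    have := Finset.card_erase_add_one h2
    omega
  have hac : (⟨(x, z), lt_trans h h'⟩ : P n) ≠ ⟨(x, y), h⟩ := by
    have := show y < z from h'
    simp [Subtype.ext_iff, Prod.ext_iff, this.ne']
  have hbc : (⟨(x, z), lt_trans h h'⟩ : P n) ≠ ⟨(y, z), h'⟩ := by
    have := show x < y from h
    simp [Subtype.ext_iff, Prod.ext_iff, this.ne]
  by_cases hc : (⟨(x, z), lt_trans h h'⟩ : P n) ∈ M
  · rw [if_pos hc, dif_neg, map_zero]
    rw [Finset.insert_eq_of_mem (by simp [hac, hbc, hc])]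
    omega
  · rw [if_neg hc, dif_pos, map_smul, ofC_single, one_smul]
    rw [Finset.card_insert_of_notMem (by simp [hc])]
    push_cast
    omega

theorem ofC_projW {k : ℤ} {w : Fin n → ℤ} (x : C n k) (N : Finset (P n)) :
    ofCw n k w (projW n k w x) N = if wt N = w then ofC n k x N else 0 := by
  induction x using Finsupp.induction_linear with
  | zero => simp
  | add x y hx hy => simp only [map_add, Pi.add_apply, hx, hy]; split_ifs <;> simp
  | single M t =>
    rw [ofC_single]
    simp only [projW, Finsupp.lsum_single]
    by_cases h : wt M.1 = w
    · simp only [dif_pos h, LinearMap.toSpanSingleton_apply, map_smul, ofCw_single, Pi.smul_apply,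
        wedge]
      grind
    · simp only [dif_neg h, LinearMap.zero_apply, map_zero, Pi.zero_apply, Pi.smul_apply, wedge]
      grind

theorem wedge_mem_Gr {k : ℤ} {w : Fin n → ℤ} (M : Bw n k w) : wedge M.1 ∈ Gr n k w := by
  intro N h
  have : M.1 = N := by by_contra h'; exact h (if_neg h')
  exact this ▸ M.2

theorem ofCw_dW (k : ℤ) (w : Fin n → ℤ) (x : Cw n (k + 1) w) :
    ofCw n k w (dW n k w x) = bd n (ofCw n (k + 1) w x) := by
  induction x using Finsupp.induction_linear with
  | zero => simp
  | add x y hx hy => simp only [map_add, hx, hy]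
  | single M t =>
    rw [← mul_one t, ← smul_eq_mul, ← Finsupp.smul_single, map_smul, map_smul, map_smul, map_smul]
    congr 1
    have h1 : d n k (inclW n (k + 1) w (Finsupp.single M 1)) = dAux k M.1 := by
      simp [inclW, d]
    ext N
    rw [dW, LinearMap.comp_apply, LinearMap.comp_apply, h1, ofC_projW, ofC_dAux M.2.1, ofCw_single,
      one_smul]
    by_cases h : wt N = w
    · rw [if_pos h]
    · rw [if_neg h]
      by_contra h'
      exact h (bd_mem_Gr (wedge_mem_Gr M) N (Ne.symm h')).2

theorem ofCw_dFromW (k : ℤ) (w : Fin n → ℤ) (x : Cw n k w) :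
    ofCw n (k - 1) w (dFromW n k w x) = bd n (ofCw n k w x) := by
  rw [dFromW, LinearMap.comp_apply, ofCw_dW]
  congr 1
  induction x using Finsupp.induction_linear with
  | zero => simp
  | add x y hx hy => simp only [map_add, hx, hy]
  | single M t => simp [castCw, ofCw_single]

theorem ofCw_apply (k : ℤ) (w : Fin n → ℤ) (x : Cw n k w) (M : Bw n k w) :
    ofCw n k w x M.1 = x M := by
  induction x using Finsupp.induction_linear with
  | zero => simp
  | add x y hx hy => simp only [map_add, Pi.add_apply, hx, hy, Finsupp.add_apply]
  | single N t =>
    rw [ofCw_single, Finsupp.single_apply, Pi.smul_apply, wedge]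
    simp [Subtype.ext_iff]

theorem ofCw_mem_Gr (k : ℤ) (w : Fin n → ℤ) (x : Cw n k w) : ofCw n k w x ∈ Gr n k w := by
  induction x using Finsupp.induction_linear with
  | zero => simp
  | add x y hx hy => rw [map_add]; exact add_mem hx hy
  | single N t => rw [ofCw_single]; exact Submodule.smul_mem _ _ (wedge_mem_Gr N)

theorem ofCw_injective (k : ℤ) (w : Fin n → ℤ) : Function.Injective (ofCw n k w) := by
  intro x y h
  ext M
  rw [← ofCw_apply, ← ofCw_apply, h]

theorem exists_ofCw_eq {k : ℤ} {w : Fin n → ℤ} {v : Fock (P n)} (hv : v ∈ Gr n k w) :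
    ∃ x, ofCw n k w x = v := by
  refine ⟨Finsupp.equivFunOnFinite.symm fun M => v M.1, funext fun N => ?_⟩
  by_cases h : (N.card : ℤ) = k ∧ wt N = w
  · exact ofCw_apply k w _ ⟨N, h⟩
  · rw [of_not_not (mt (hv N) h)]
    exact of_not_not (mt (ofCw_mem_Gr k w _ N) h)

theorem mem_ZW {k : ℤ} {w : Fin n → ℤ} {x : Cw n k w} :
    x ∈ ZW n k w ↔ bd n (ofCw n k w x) = 0 := by
  rw [ZW, LinearMap.mem_ker, ← ofCw_dFromW, ← (ofCw_injective (k - 1) w).eq_iff, map_zero]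

theorem mem_HwSub {k : ℤ} {w : Fin n → ℤ} {x : ZW n k w} :
    x ∈ HwSub n k w ↔ ∃ u ∈ Gr n (k + 1) w, bd n u = ofCw n k w x.1 := by
  rw [HwSub, Submodule.mem_comap, Submodule.mem_inf]
  constructor
  · rintro ⟨⟨u, hu⟩, -⟩
    refine ⟨_, ofCw_mem_Gr _ _ u, ?_⟩
    rw [← ofCw_dW, hu]; rfl
  · rintro ⟨u, hu, h⟩
    obtain ⟨u, rfl⟩ := exists_ofCw_eq hu
    refine ⟨⟨u, ofCw_injective _ _ ?_⟩, x.2⟩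
    rw [ofCw_dW, h]; rfl

theorem exists_bd_eq_of_subsingleton {k : ℤ} {w : Fin n → ℤ} (h : Subsingleton (Hw n k w))
    {v : Fock (P n)} (hv : v ∈ Gr n k w) (hv0 : bd n v = 0) :
    ∃ u ∈ Gr n (k + 1) w, bd n u = v := by
  obtain ⟨x, rfl⟩ := exists_ofCw_eq hv
  have h' : HwSub n k w = ⊤ := Submodule.Quotient.subsingleton_iff.1 h
  exact mem_HwSub.1 (h' ▸ Submodule.mem_top : (⟨x, mem_ZW.2 hv0⟩ : ZW n k w) ∈ HwSub n k w)

/-- A chain map whose kernel and cokernel are acyclic induces an isomorphism on homology. -/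
theorem nonempty_Hw_equiv {n' : ℕ} {k k' : ℤ} {w : Fin n → ℤ} {w' : Fin n' → ℤ}
    (g : Fock (P n) →ₗ[ℤ] Fock (P n'))
    (hg : ∀ s, ∀ x ∈ Gr n (k + s) w, g x ∈ Gr n' (k' + s) w')
    (hcomm : ∀ x, g (bd n x) = bd n' (g x))
    (hker : ∀ s, ∀ x ∈ Gr n (k + s) w, g x = 0 → bd n x = 0 →
      ∃ u ∈ Gr n (k + s + 1) w, g u = 0 ∧ bd n u = x)
    (hcoker : ∀ s, ∀ a ∈ Gr n' (k' + s) w', (∃ b, bd n' a = g b) →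
      ∃ u ∈ Gr n' (k' + s + 1) w', ∃ b ∈ Gr n (k + s) w, a = bd n' u + g b) :
    Nonempty (Hw n k w ≃ₗ[ℤ] Hw n' k' w') := by
  have hg0 : ∀ x ∈ Gr n k w, g x ∈ Gr n' k' w' := by simpa using hg 0
  have hex : ∀ x : ZW n k w, ∃ y : ZW n' k' w', ofCw n' k' w' y.1 = g (ofCw n k w x.1) := by
    intro x
    obtain ⟨y, hy⟩ := exists_ofCw_eq (hg0 _ (ofCw_mem_Gr k w x.1))
    refine ⟨⟨y, mem_ZW.2 ?_⟩, hy⟩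
    rw [hy, ← hcomm, mem_ZW.1 x.2, map_zero]
  choose f hf using hex
  have hinj : ∀ {y y' : ZW n' k' w'}, ofCw n' k' w' y.1 = ofCw n' k' w' y'.1 → y = y' :=
    fun h => Subtype.ext (ofCw_injective _ _ h)
  let f' : ZW n k w →ₗ[ℤ] ZW n' k' w' :=
    { toFun := f
      map_add' := fun x y => hinj (by simp only [hf, Submodule.coe_add, map_add])
      map_smul' := fun t x => hinj (by
        simp only [hf, Submodule.coe_smul, map_smul, RingHom.id_apply]) }
  let F : ZW n k w →ₗ[ℤ] (ZW n' k' w' ⧸ HwSub n' k' w') := (HwSub n' k' w').mkQ ∘ₗ f'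
  have hsurj : Function.Surjective F := by
    intro q
    obtain ⟨z, rfl⟩ := (HwSub n' k' w').mkQ_surjective q
    have hz := mem_ZW.1 z.2
    obtain ⟨u, hu, b, hb, hzu⟩ := hcoker 0 (ofCw n' k' w' z.1)
      (by simpa using ofCw_mem_Gr _ _ _) ⟨0, by simp [hz]⟩
    rw [add_zero] at hu hb
    have hgb : g (bd n b) = 0 := by
      rw [hcomm, ← hz, hzu, map_add, bd_bd, zero_add]
    obtain ⟨u', hu', hgu', hbu'⟩ := hker (-1) (bd n b)
      (bd_mem_Gr (by rwa [neg_add_cancel_right])) hgb (bd_bd b)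
    rw [neg_add_cancel_right] at hu'
    obtain ⟨x, hx⟩ := exists_ofCw_eq (sub_mem hb hu')
    have hxZ : x ∈ ZW n k w := by rw [mem_ZW, hx, map_sub, hbu', sub_self]
    refine ⟨⟨x, hxZ⟩, (Submodule.Quotient.eq _).2 (mem_HwSub.2 ⟨-u, neg_mem hu, ?_⟩)⟩
    have h1 : ofCw n' k' w' (f ⟨x, hxZ⟩).1 = g b := by rw [hf, hx, map_sub, hgu', sub_zero]
    rw [Submodule.coe_sub, map_sub, hzu]
    change _ = ofCw n' k' w' (f ⟨x, hxZ⟩).1 - _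
    rw [h1, map_neg]
    abel
  have hkerF : HwSub n k w = LinearMap.ker F := by
    ext x
    have h1 : x ∈ LinearMap.ker F ↔ f x ∈ HwSub n' k' w' :=
      Submodule.Quotient.mk_eq_zero (HwSub n' k' w')
    rw [h1, mem_HwSub, mem_HwSub, hf]
    constructor
    · rintro ⟨u, hu, h⟩
      exact ⟨g u, hg 1 u hu, by rw [← hcomm, h]⟩
    · rintro ⟨a, ha, h⟩
      obtain ⟨u, -, b, hb, rfl⟩ := hcoker 1 a ha ⟨_, h⟩
      obtain ⟨v, hv, -, hv'⟩ := hker 0 (ofCw n k w x.1 - bd n b)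
        (by rw [add_zero]; exact sub_mem (ofCw_mem_Gr _ _ _) (bd_mem_Gr hb))
        (by rw [map_sub, hcomm, ← h, map_add, bd_bd, zero_add, sub_self])
        (by rw [map_sub, mem_ZW.1 x.2, bd_bd, sub_self])
      rw [add_zero] at hv
      exact ⟨v + b, add_mem hv hb, by rw [map_add, hv', sub_add_cancel]⟩
  exact ⟨(Submodule.quotEquivOfEq _ _ hkerF).trans (F.quotKerEquivOfSurjective hsurj)⟩

end Boundary

section Permute

variable {n : ℕ} (σ : Equiv.Perm (Fin n))

/-- Relabel a pair along `σ`, sorting the result. -/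
def permP (p : P n) : P n :=
  if h : σ p.1.1 < σ p.1.2 then ⟨(σ p.1.1, σ p.1.2), h⟩
  else ⟨(σ p.1.2, σ p.1.1), lt_of_le_of_ne (not_lt.1 h) (σ.injective.ne p.2.ne')⟩

theorem permP_injective : Function.Injective (permP σ) := by
  rintro ⟨⟨a, b⟩, h⟩ ⟨⟨a', b'⟩, h'⟩ e
  have h1 : a < b := h
  have h2 : a' < b' := h'
  have hi : ∀ u v, σ u = σ v → u = v := fun u v => σ.injective.eq_iff.1
  unfold permP at e
  refine Subtype.ext (Prod.ext ?_ ?_) <;> grind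

/-- `permP` as a permutation of the pairs. -/
noncomputable def permPEquiv : P n ≃ P n :=
  Equiv.ofBijective (permP σ) (Finite.injective_iff_bijective.1 (permP_injective σ))

theorem permPEquiv_of_lt {x y : Fin n} (h : x < y) (h' : σ x < σ y) :
    permPEquiv σ ⟨(x, y), h⟩ = ⟨(σ x, σ y), h'⟩ :=
  dif_pos h'

theorem permPEquiv_of_gt {x y : Fin n} (h : x < y) (h' : σ y < σ x) :
    permPEquiv σ ⟨(x, y), h⟩ = ⟨(σ y, σ x), h'⟩ :=
  dif_neg h'.not_gt

/-- Relabelling along `σ`, exchanging occupied and empty modes at the inversions of `σ`. -/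
noncomputable def permFock : Fock (P n) ≃ₗ[ℤ] Fock (P n) :=
  unflip key key (permPEquiv σ) (invFinset σ)

/-- The action of `permFock` on basis wedges. -/
noncomputable def permWedge : Finset (P n) ≃ Finset (P n) := flip (permPEquiv σ) (invFinset σ)

theorem mem_invFinset {p : P n} : p ∈ invFinset σ ↔ σ p.1.2 < σ p.1.1 := by simp [invFinset]

theorem permFock_cr {x y : Fin n} (h : x < y ↔ σ x < σ y) (v : Fock (P n)) :
    permFock σ (cr (σ x) (σ y) v) = cr x y (permFock σ v) := by
  by_cases hxy : x < y
  · rw [cr_of_lt hxy, cr_of_lt (h.1 hxy), ← permPEquiv_of_lt σ hxy (h.1 hxy)]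
    refine unflip_cre _ key_injective key_injective ?_ v
    rw [mem_invFinset]; exact (h.1 hxy).not_gt
  · rw [cr_of_not_lt hxy, cr_of_not_lt (mt h.2 hxy)]; simp

theorem permFock_an {x y : Fin n} (h : x < y ↔ σ x < σ y) (v : Fock (P n)) :
    permFock σ (an (σ x) (σ y) v) = an x y (permFock σ v) := by
  by_cases hxy : x < y
  · rw [an_of_lt hxy, an_of_lt (h.1 hxy), ← permPEquiv_of_lt σ hxy (h.1 hxy)]
    refine unflip_ann _ key_injective key_injective ?_ v
    rw [mem_invFinset]; exact (h.1 hxy).not_gt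
  · rw [an_of_not_lt hxy, an_of_not_lt (mt h.2 hxy)]; simp

theorem permFock_cr_of_gt {x y : Fin n} (h : x < y) (h' : σ y < σ x) (v : Fock (P n)) :
    permFock σ (cr (σ y) (σ x) v) = an x y (permFock σ v) := by
  rw [an_of_lt h, cr_of_lt h', ← permPEquiv_of_gt σ h h']
  exact unflip_cre_of_mem _ key_injective key_injective ((mem_invFinset σ).2 h') v

theorem permFock_an_of_gt {x y : Fin n} (h : x < y) (h' : σ y < σ x) (v : Fock (P n)) :
    permFock σ (an (σ y) (σ x) v) = cr x y (permFock σ v) := by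
  rw [cr_of_lt h, an_of_lt h', ← permPEquiv_of_gt σ h h']
  exact unflip_ann_of_mem _ key_injective key_injective ((mem_invFinset σ).2 h') v

theorem permFock_apply_ne_zero {v : Fock (P n)} {M : Finset (P n)} :
    permFock σ v M ≠ 0 ↔ v (permWedge σ M) ≠ 0 := by
  have h := flipSign_mul_self key key (permPEquiv σ) (invFinset σ) M
  rw [permFock, unflip_apply, mul_ne_zero_iff]
  exact and_iff_right (left_ne_zero_of_mul (h ▸ one_ne_zero))

theorem card_permWedge (M : Finset (P n)) :
    ((permWedge σ M).card : ℤ) =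
      M.card - 2 * (M.filter (· ∈ invFinset σ)).card + (invFinset σ).card := by
  have h := sum_flip (permPEquiv σ) (F := invFinset σ) (fun _ => (1 : ℤ)) M
  rw [permWedge, Finset.cast_card, h, Finset.sum_ite, ← Finset.card_filter_add_card_filter_not
    (s := M) (· ∈ invFinset σ)]
  simp
  ring

theorem sum_invFinset_wtP (i : Fin n) : ∑ p ∈ invFinset σ, wtP p i = (σ i : ℤ) - i := by
  have h1 : ∀ k : Fin n, (∑ y : Fin n, if y < k then (1 : ℤ) else 0) = k := by
    intro k
    rw [Finset.sum_boole, Finset.filter_gt_eq_Iio, Fin.card_Iio]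
  have h2 : (∑ y : Fin n, if σ y < σ i then (1 : ℤ) else 0) = σ i := by
    rw [Equiv.sum_comp σ fun z => if z < σ i then (1 : ℤ) else 0, h1]
  conv_rhs => rw [← h1 i, ← h2, ← Finset.sum_sub_distrib]
  rw [invFinset, Finset.sum_filter, ← sum_sum_dite_lt]
  have h3 : ∀ x y : Fin n, (if h : x < y then
      (if σ y < σ x then wtP (⟨(x, y), h⟩ : P n) i else 0) else 0) =
      (if x = i then (if x < y ∧ σ y < σ x then 1 else 0) else 0) -
        if y = i then (if x < y ∧ σ y < σ x then 1 else 0) else 0 := by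
    intro x y
    simp only [wtP]
    grind
  simp only [h3, Finset.sum_sub_distrib]
  rw [Finset.sum_comm]
  simp only [Finset.sum_ite_eq', Finset.mem_univ, if_true]
  simp only [← Finset.sum_sub_distrib]
  refine Finset.sum_congr rfl fun y _ => ?_
  rcases lt_trichotomy i y with h | h | h
  · simp [h, h.not_gt]
  · simp [h]
  · have := σ.injective.ne h.ne
    simp only [h, h.not_gt, if_true, true_and, false_and, if_false]
    grind

theorem wt_permWedge (M : Finset (P n)) (i : Fin n) : wt (permWedge σ M) (σ i) = wt M i := by
  have h : ∀ p : P n, wtP (permPEquiv σ p) (σ i) =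
      if p ∈ invFinset σ then -wtP p i else wtP p i := by
    rintro ⟨⟨x, y⟩, hxy⟩
    by_cases h : σ y < σ x
    · rw [if_pos ((mem_invFinset σ).2 h), permPEquiv_of_gt σ hxy h]; simp [wtP]
    · rw [if_neg (mt (mem_invFinset σ).1 h), permPEquiv_of_lt σ hxy
        (lt_of_le_of_ne (not_lt.1 h) (σ.injective.ne hxy.ne))]
      simp [wtP]
  have h' := sum_flip (permPEquiv σ) (F := invFinset σ) (fun p => wtP p (σ i)) M
  rw [wt_apply, wt_apply, permWedge, h']
  have h1 : ∀ p : P n, (if p ∈ invFinset σ then -wtP (permPEquiv σ p) (σ i)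
      else wtP (permPEquiv σ p) (σ i)) = wtP p i := by
    intro p; rw [h]; split_ifs <;> simp
  have h2 : ∑ p ∈ invFinset σ, wtP (permPEquiv σ p) (σ i) = -((σ i : ℤ) - i) := by
    rw [← sum_invFinset_wtP, ← Finset.sum_neg_distrib]
    exact Finset.sum_congr rfl fun p hp => by rw [h, if_pos hp]
  simp only [h1, h2]
  ring

end Permute

section Rotate

variable {m : ℕ}

/-- The permutation fixing `0`, sending `1` to the last index and shifting the others down. -/
def rot (m : ℕ) : Equiv.Perm (Fin (m + 2)) where
  toFun := Fin.cases 0 (Fin.cases (Fin.last (m + 1)) fun y => y.castSucc.succ)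
  invFun := Fin.cases 0 (Fin.lastCases 1 fun y => y.succ.succ)
  left_inv i := by
    refine Fin.cases rfl (fun i => Fin.cases ?_ (fun i => ?_) i) i
    · change (Fin.lastCases 1 (fun y => y.succ.succ) (Fin.last m) : Fin (m + 2)) = 1
      simp
    · simp
  right_inv i := by
    refine Fin.cases rfl (fun i => Fin.lastCases ?_ (fun i => ?_) i) i
    · simp only [Fin.cases_succ, Fin.lastCases_last]; rfl
    · simp

@[simp] theorem rot_zero : rot m 0 = 0 := rfl

@[simp] theorem rot_one : rot m 1 = Fin.last (m + 1) := rfl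

@[simp] theorem rot_succ_succ (y : Fin m) : rot m y.succ.succ = y.castSucc.succ := rfl

/-- The pair indexing `e_{12}`. -/
abbrev p01 (m : ℕ) : P (m + 2) := ⟨(0, 1), by simp⟩

theorem mem_invFinset_rot {p : P (m + 2)} : p ∈ invFinset (rot m) ↔ p.1.1 = 1 := by
  obtain ⟨⟨x, y⟩, h⟩ := p
  rw [mem_invFinset]
  simp only at h ⊢
  cases x using Fin.cases with
  | zero => simp
  | succ x =>
    cases x using Fin.cases with
    | zero =>
      cases y using Fin.cases with
      | zero => simp at h
      | succ y =>
        cases y using Fin.cases with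
        | zero => simp at h
        | succ y => simp [Fin.lt_def]
    | succ x =>
      cases y using Fin.cases with
      | zero => simp at h
      | succ y =>
        cases y using Fin.cases with
        | zero => simp [Fin.lt_def] at h
        | succ y =>
          have : ¬ y < x := by simpa using (le_of_lt (by simpa using h))
          simp [Fin.ext_iff]
          omega

theorem card_invFinset_rot : ((invFinset (rot m)).card : ℤ) = m := by
  have h := sum_invFinset_wtP (rot m) 1
  rw [Finset.sum_congr rfl (g := fun _ => (1 : ℤ))] at h
  · simpa using h
  · intro p hp
    have h1 := mem_invFinset_rot.1 hp
    have h2 := p.2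
    simp [wtP, h1, (h1 ▸ h2).ne']

theorem card_permWedge_rot (M : Finset (P (m + 2))) :
    ((permWedge (rot m) M).card : ℤ) =
      M.card - (2 * wt M 1 - m - 4) - if p01 m ∈ M then 2 else 0 := by
  have h1 : (M.filter fun p => p.1.2 = 1).card = if p01 m ∈ M then 1 else 0 := by
    have : (M.filter fun p => p.1.2 = 1) = M.filter fun p => p = p01 m := by
      refine Finset.filter_congr fun p _ => ?_
      obtain ⟨⟨x, y⟩, h⟩ := p
      simp only [Subtype.ext_iff, Prod.ext_iff]
      constructor
      · rintro rfl
        exact ⟨(Fin.lt_one_iff _).1 h, rfl⟩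
      · exact fun h => h.2
    rw [this, Finset.filter_eq']
    split_ifs <;> simp
  rw [card_permWedge, card_invFinset_rot, wt, h1]
  simp only [mem_invFinset_rot]
  split_ifs <;> simp <;> ring

/-- The part of the boundary not involving `e_{12}` as a factor of a bracket. -/
noncomputable def bd₀ (m : ℕ) : Module.End ℤ (Fock (P (m + 2))) :=
  (∑ y : Fin m, ∑ z : Fin m,
      cr 0 z.succ.succ * (an 0 y.succ.succ * an y.succ.succ z.succ.succ)) +
    (∑ y : Fin m, ∑ z : Fin m,
      cr 1 z.succ.succ * (an 1 y.succ.succ * an y.succ.succ z.succ.succ)) +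
    ∑ x : Fin m, ∑ y : Fin m, ∑ z : Fin m,
      cr x.succ.succ z.succ.succ * (an x.succ.succ y.succ.succ * an y.succ.succ z.succ.succ)

/-- The part of the boundary involving brackets with `e_{12}`. -/
noncomputable def bd₁ (m : ℕ) : Module.End ℤ (Fock (P (m + 2))) :=
  ∑ z : Fin m, cr 0 z.succ.succ * (an 0 1 * an 1 z.succ.succ)

theorem bd_eq_bd₀_add_bd₁ : bd (m + 2) = bd₀ m + bd₁ m := by
  have a0 : ∀ x : Fin (m + 2), an x 0 = 0 := fun x => an_of_not_lt (by simp)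
  have c0 : ∀ x : Fin (m + 2), cr x 0 = 0 := fun x => cr_of_not_lt (by simp)
  have a1 : an (1 : Fin (m + 2)) 1 = 0 := an_of_not_lt (by simp)
  have a2 : ∀ x : Fin m, an x.succ.succ 1 = 0 := fun x => an_of_not_lt (by simp [Fin.lt_def])
  simp only [bd, bd₀, bd₁, Fin.sum_univ_succ, Fin.succ_zero_eq_one, a0, c0, a1, a2,
    mul_zero, zero_mul, add_zero, zero_add, Finset.sum_const_zero, Finset.sum_add_distrib]
  abel

/-- The part of the boundary not producing `e_{1n}`. -/
noncomputable def bd₀' (m : ℕ) : Module.End ℤ (Fock (P (m + 2))) :=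
  (∑ y : Fin m, ∑ z : Fin m,
      cr 0 z.castSucc.succ * (an 0 y.castSucc.succ * an y.castSucc.succ z.castSucc.succ)) +
    (∑ y : Fin m, ∑ z : Fin m,
      cr y.castSucc.succ (Fin.last (m + 1)) *
        (an y.castSucc.succ z.castSucc.succ * an z.castSucc.succ (Fin.last (m + 1)))) +
    ∑ x : Fin m, ∑ y : Fin m, ∑ z : Fin m,
      cr x.castSucc.succ z.castSucc.succ *
        (an x.castSucc.succ y.castSucc.succ * an y.castSucc.succ z.castSucc.succ)

/-- The part of the boundary producing `e_{1n}`. -/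
noncomputable def bd₁' (m : ℕ) : Module.End ℤ (Fock (P (m + 2))) :=
  ∑ y : Fin m, cr 0 (Fin.last (m + 1)) *
    (an 0 y.castSucc.succ * an y.castSucc.succ (Fin.last (m + 1)))

theorem bd_eq_bd₀'_add_bd₁' : bd (m + 2) = bd₀' m + bd₁' m := by
  have a0 : ∀ x : Fin (m + 2), an x 0 = 0 := fun x => an_of_not_lt (by simp)
  have c0 : ∀ x : Fin (m + 2), cr x 0 = 0 := fun x => cr_of_not_lt (by simp)
  have aL : ∀ x : Fin (m + 2), an (Fin.last (m + 1)) x = 0 :=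
    fun x => an_of_not_lt (Fin.le_last x).not_gt
  have cL : ∀ x : Fin (m + 2), cr (Fin.last (m + 1)) x = 0 :=
    fun x => cr_of_not_lt (Fin.le_last x).not_gt
  simp only [bd, bd₀', bd₁', Fin.sum_univ_succ (n := m + 1), Fin.sum_univ_castSucc (n := m),
    Fin.succ_last, a0, c0, aL, cL,
    mul_zero, zero_mul, add_zero, zero_add, Finset.sum_const_zero, Finset.sum_add_distrib]
  abel

section Intertwine

variable (v : Fock (P (m + 2)))

theorem rot_cr_zero (y : Fin m) : permFock (rot m) (cr 0 y.castSucc.succ v) =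
    cr 0 y.succ.succ (permFock (rot m) v) := by
  simpa using permFock_cr (rot m) (x := 0) (y := y.succ.succ) (by simp) v

theorem rot_an_zero (y : Fin m) : permFock (rot m) (an 0 y.castSucc.succ v) =
    an 0 y.succ.succ (permFock (rot m) v) := by
  simpa using permFock_an (rot m) (x := 0) (y := y.succ.succ) (by simp) v

theorem rot_cr_mid (x y : Fin m) : permFock (rot m) (cr x.castSucc.succ y.castSucc.succ v) =
    cr x.succ.succ y.succ.succ (permFock (rot m) v) := by
  simpa using permFock_cr (rot m) (x := x.succ.succ) (y := y.succ.succ) (by simp) v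

theorem rot_an_mid (x y : Fin m) : permFock (rot m) (an x.castSucc.succ y.castSucc.succ v) =
    an x.succ.succ y.succ.succ (permFock (rot m) v) := by
  simpa using permFock_an (rot m) (x := x.succ.succ) (y := y.succ.succ) (by simp) v

theorem rot_cr_last (y : Fin m) :
    permFock (rot m) (cr y.castSucc.succ (Fin.last (m + 1)) v) =
      an 1 y.succ.succ (permFock (rot m) v) := by
  simpa using permFock_cr_of_gt (rot m) (x := 1) (y := y.succ.succ) (by simp [Fin.lt_def])
    (by simp [Fin.lt_def]) v

theorem rot_an_last (y : Fin m) :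
    permFock (rot m) (an y.castSucc.succ (Fin.last (m + 1)) v) =
      cr 1 y.succ.succ (permFock (rot m) v) := by
  simpa using permFock_an_of_gt (rot m) (x := 1) (y := y.succ.succ) (by simp [Fin.lt_def])
    (by simp [Fin.lt_def]) v

theorem rot_cr_zero_last : permFock (rot m) (cr 0 (Fin.last (m + 1)) v) =
    cr 0 1 (permFock (rot m) v) := by
  simpa using permFock_cr (rot m) (x := 0) (y := 1) (by simp [Fin.lt_def]) v

theorem rot_bd₀' : permFock (rot m) (bd₀' m v) = bd₀ m (permFock (rot m) v) := by
  have h : ∀ y z : Fin m,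
      an (1 : Fin (m + 2)) y.succ.succ * (an y.succ.succ z.succ.succ * cr 1 z.succ.succ) =
        cr 1 z.succ.succ * (an 1 y.succ.succ * an y.succ.succ z.succ.succ) := by
    intro y z
    by_cases hyz : y = z
    · subst hyz
      rw [an_of_not_lt (lt_irrefl _)]; simp
    · have h1 : ¬(y.succ.succ = 1 ∧ z.succ.succ = z.succ.succ ∧ y.succ.succ < z.succ.succ) := by
        simp [Fin.ext_iff]
      rw [an_mul_cr, if_neg h1, zero_sub, mul_neg, ← mul_assoc, an_mul_cr, if_neg (by simp [hyz])]
      simp [mul_assoc]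
  simp only [bd₀', bd₀, LinearMap.add_apply, LinearMap.sum_apply, map_add, map_sum,
    Module.End.mul_apply, rot_cr_zero, rot_an_zero, rot_cr_mid, rot_an_mid, rot_cr_last,
    rot_an_last]
  congr 2
  refine Finset.sum_congr rfl fun y _ => Finset.sum_congr rfl fun z _ => ?_
  exact LinearMap.congr_fun (h y z) _

theorem rot_bd₁' : permFock (rot m) (bd₁' m v) =
    ∑ y : Fin m, cr 0 1 (an 0 y.succ.succ (cr 1 y.succ.succ (permFock (rot m) v))) := by
  simp only [bd₁', LinearMap.sum_apply, map_sum, Module.End.mul_apply, rot_cr_zero_last,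
    rot_an_zero, rot_an_last]

end Intertwine

theorem anticomm_triple {A : Type*} [Ring A] {e a b c : A} (ha : e * a = -(a * e))
    (hb : e * b = -(b * e)) (hc : e * c = -(c * e)) :
    e * (a * (b * c)) = -(a * (b * c) * e) := by
  rw [← mul_assoc, ha, neg_mul, mul_assoc, ← mul_assoc e, hb, neg_mul, mul_assoc b, hc]
  noncomm_ring

theorem an_mul_bd₀ : an 0 1 * bd₀ m = -(bd₀ m * an 0 1) := by
  have h : ∀ x z : Fin (m + 2), z ≠ 1 → an 0 1 * cr x z = -(cr x z * an 0 1) := by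
    intro x z hz
    rw [an_mul_cr, if_neg (fun h => hz h.2.1.symm), zero_sub]
  have h1 : ∀ y : Fin m, y.succ.succ ≠ 1 := by simp [Fin.ext_iff]
  simp only [bd₀, mul_add, add_mul, Finset.mul_sum, Finset.sum_mul,
    anticomm_triple (h _ _ (h1 _)) (an_mul_an 0 1 _ _) (an_mul_an 0 1 _ _),
    Finset.sum_neg_distrib, neg_add]

theorem cr_mul_bd₀ : cr 0 1 * bd₀ m = -(bd₀ m * cr 0 1) := by
  have h : ∀ x z : Fin (m + 2), z ≠ 1 → cr 0 1 * an x z = -(an x z * cr 0 1) := by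
    intro x z hz
    rw [an_mul_cr, if_neg (fun h => hz h.2.1), zero_sub, neg_neg]
  have h1 : ∀ y : Fin m, y.succ.succ ≠ 1 := by simp [Fin.ext_iff]
  simp only [bd₀, mul_add, add_mul, Finset.mul_sum, Finset.sum_mul,
    anticomm_triple (cr_mul_cr 0 1 _ _) (h _ _ (h1 _)) (h _ _ (h1 _)),
    Finset.sum_neg_distrib, neg_add]

/-- The projection onto the wedges without a factor `e_{12}`. -/
def avoid (m : ℕ) : Module.End ℤ (Fock (P (m + 2))) := 1 - cr 0 1 * an 0 1

theorem avoid_apply (v : Fock (P (m + 2))) (M : Finset (P (m + 2))) :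
    avoid m v M = if p01 m ∈ M then 0 else v M := by
  rw [avoid, cr_of_lt (by simp), an_of_lt (by simp)]
  simp only [LinearMap.sub_apply, Module.End.mul_apply, Module.End.one_apply, Pi.sub_apply,
    cre_apply, ann_apply]
  by_cases h : p01 m ∈ M
  · rw [if_pos h, if_pos h, if_neg (Finset.notMem_erase _ _), Finset.insert_erase h,
      jw_erase _ _ h, sgn_self, one_mul, ← mul_assoc, jw_mul_self, one_mul, sub_self]
  · rw [if_neg h, if_neg h, sub_zero]

theorem cr_mul_self (x y : Fin (m + 2)) : cr x y * cr x y = 0 := by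
  refine LinearMap.ext fun v => funext fun M => ?_
  have h := congrFun (LinearMap.congr_fun (cr_mul_cr x y x y) v) M
  rw [LinearMap.neg_apply, Pi.neg_apply] at h
  rw [LinearMap.zero_apply, Pi.zero_apply]
  omega

theorem an_mul_self (x y : Fin (m + 2)) : an x y * an x y = 0 := by
  refine LinearMap.ext fun v => funext fun M => ?_
  have h := congrFun (LinearMap.congr_fun (an_mul_an x y x y) v) M
  rw [LinearMap.neg_apply, Pi.neg_apply] at h
  rw [LinearMap.zero_apply, Pi.zero_apply]
  omega

theorem an_mul_cr_self : an 0 1 * cr 0 1 = 1 - cr (0 : Fin (m + 2)) 1 * an 0 1 := by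
  rw [an_mul_cr, if_pos (by simp)]

theorem avoid_mul_cr : avoid m * cr 0 1 = 0 := by
  rw [avoid, sub_mul, mul_assoc, an_mul_cr_self, mul_sub, ← mul_assoc, cr_mul_self]
  simp

theorem an_mul_avoid : an 0 1 * avoid m = 0 := by
  rw [avoid, mul_sub, ← mul_assoc, an_mul_cr_self, sub_mul, mul_assoc, an_mul_self]
  simp

theorem avoid_mul_bd₀ : avoid m * bd₀ m = bd₀ m * avoid m := by
  rw [avoid, sub_mul, mul_sub, mul_assoc, an_mul_bd₀, mul_neg, ← mul_assoc, cr_mul_bd₀]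
  noncomm_ring

theorem bd₁_mul_avoid : bd₁ m * avoid m = 0 := by
  rw [bd₁, Finset.sum_mul]
  refine Finset.sum_eq_zero fun z _ => ?_
  rw [an_mul_an, mul_neg, neg_mul, mul_assoc, mul_assoc, an_mul_avoid]
  simp

theorem avoid_mul_bd₁ : avoid m * bd₁ m = bd₁ m := by
  have h : an 0 1 * bd₁ m = 0 := by
    rw [bd₁, Finset.mul_sum]
    refine Finset.sum_eq_zero fun z _ => ?_
    rw [← mul_assoc, an_mul_cr, if_neg (by simp [Fin.ext_iff]), zero_sub, neg_mul, mul_assoc,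
      ← mul_assoc (an 0 1), an_mul_self]
    simp
  rw [avoid, sub_mul, mul_assoc, h]
  simp

theorem avoid_mem_Gr {k : ℤ} {w : Fin (m + 2) → ℤ} {v : Fock (P (m + 2))}
    (hv : v ∈ Gr (m + 2) k w) : avoid m v ∈ Gr (m + 2) k w := by
  intro M h
  rw [avoid_apply] at h
  split_ifs at h with h'
  · exact absurd rfl h
  · exact hv M h

theorem bd₁_mem_Gr {k : ℤ} {w : Fin (m + 2) → ℤ} {v : Fock (P (m + 2))}
    (hv : v ∈ Gr (m + 2) (k + 1) w) : bd₁ m v ∈ Gr (m + 2) k w := by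
  rw [bd₁, LinearMap.sum_apply]
  exact sum_mem fun z _ => term_mem_Gr _ _ _ hv

theorem bd₀_mem_Gr {k : ℤ} {w : Fin (m + 2) → ℤ} {v : Fock (P (m + 2))}
    (hv : v ∈ Gr (m + 2) (k + 1) w) : bd₀ m v ∈ Gr (m + 2) k w := by
  have h := sub_mem (bd_mem_Gr hv) (bd₁_mem_Gr hv)
  rwa [bd_eq_bd₀_add_bd₁, LinearMap.add_apply, add_sub_cancel_right] at h

/-- The part of the target boundary that produces `e_{1n}` vanishes on wedges containing it. -/
theorem bd₁'_eq_zero {v : Fock (P (m + 2))} (hv : avoid m (permFock (rot m) v) = 0) :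
    bd₁' m v = 0 := by
  rw [← (permFock (rot m)).map_eq_zero_iff, rot_bd₁']
  refine Finset.sum_eq_zero fun y _ => ?_
  have h1 : permFock (rot m) v = cr 0 1 (an 0 1 (permFock (rot m) v)) := by
    rw [← sub_eq_zero]; exact hv
  have h2 : cr 0 1 * (an 0 y.succ.succ * (cr 1 y.succ.succ * cr (0 : Fin (m + 2)) 1)) = 0 := by
    rw [cr_mul_cr, mul_neg, ← mul_assoc (an 0 _), an_mul_cr, if_neg (by simp [Fin.ext_iff]),
      zero_sub, mul_neg, neg_mul, mul_neg, neg_neg, mul_assoc, ← mul_assoc, cr_mul_self, zero_mul]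
  rw [h1]
  exact LinearMap.congr_fun h2 _

end Rotate

section Restrict

variable {m : ℕ}

/-- The index shift `e_{ab} ↦ e_{a+1,b+1}`. -/
def succP (m : ℕ) : P (m + 1) ↪ P (m + 2) where
  toFun p := ⟨(p.1.1.succ, p.1.2.succ), Fin.succ_lt_succ_iff.2 p.2⟩
  inj' p q h := by simpa [Subtype.ext_iff, Prod.ext_iff] using h

@[simp] theorem val_succP (p : P (m + 1)) : (succP m p).1 = (p.1.1.succ, p.1.2.succ) := rfl

theorem key_succP (p q : P (m + 1)) : key (succP m p) < key (succP m q) ↔ key p < key q := by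
  rw [key_lt_key, key_lt_key]
  simp

theorem zero_notMem_range_succP {z : Fin (m + 2)} (h : 0 < z) :
    (⟨(0, z), h⟩ : P (m + 2)) ∉ Set.range (succP m) := by
  rintro ⟨p, hp⟩
  exact Fin.succ_ne_zero _ (congrArg (fun q : P (m + 2) => q.1.1) hp)

theorem p01_notMem_map (M : Finset (P (m + 1))) : p01 m ∉ M.map (succP m) := by
  rw [Finset.mem_map]
  rintro ⟨p, -, hp⟩
  exact zero_notMem_range_succP _ ⟨p, hp⟩

section Boundary

variable (v : Fock (P (m + 2)))

theorem restr_cr_zero (z : Fin (m + 2)) : restr (succP m) (cr 0 z v) = 0 := by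
  by_cases h : 0 < z
  · rw [cr_of_lt h]
    exact restr_cre_of_notMem key _ (zero_notMem_range_succP h) v
  · rw [cr_of_not_lt h]; simp

theorem restr_cr (x z : Fin (m + 1)) :
    restr (succP m) (cr x.succ z.succ v) = cr x z (restr (succP m) v) := by
  by_cases h : x < z
  · rw [cr_of_lt h, cr_of_lt (Fin.succ_lt_succ_iff.2 h)]
    exact restr_cre (succP m) key_succP ⟨(x, z), h⟩ v
  · rw [cr_of_not_lt h, cr_of_not_lt (mt Fin.succ_lt_succ_iff.1 h)]; simp

theorem restr_an (x z : Fin (m + 1)) :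
    restr (succP m) (an x.succ z.succ v) = an x z (restr (succP m) v) := by
  by_cases h : x < z
  · rw [an_of_lt h, an_of_lt (Fin.succ_lt_succ_iff.2 h)]
    exact restr_ann (succP m) key_succP ⟨(x, z), h⟩ v
  · rw [an_of_not_lt h, an_of_not_lt (mt Fin.succ_lt_succ_iff.1 h)]; simp

theorem restr_bd : restr (succP m) (bd (m + 2) v) = bd (m + 1) (restr (succP m) v) := by
  have a0 : ∀ x : Fin (m + 2), an x 0 = 0 := fun x => an_of_not_lt (by simp)
  have c0 : ∀ x : Fin (m + 2), cr x 0 = 0 := fun x => cr_of_not_lt (by simp)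
  simp only [bd, Fin.sum_univ_succ (n := m + 1), a0, c0, mul_zero, zero_mul, zero_add,
    Finset.sum_const_zero, LinearMap.add_apply, LinearMap.sum_apply, map_add, map_sum,
    Module.End.mul_apply, restr_cr_zero, restr_cr, restr_an]

theorem restr_bd₀ : restr (succP m) (bd₀ m v) = bd (m + 1) (restr (succP m) v) := by
  have h : restr (succP m) (bd₁ m v) = 0 := by
    simp only [bd₁, LinearMap.sum_apply, map_sum, Module.End.mul_apply, restr_cr_zero,
      Finset.sum_const_zero]
  rw [← restr_bd, bd_eq_bd₀_add_bd₁, LinearMap.add_apply, map_add, h, add_zero]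

theorem restr_an_zero_one_apply (M : Finset (P (m + 1))) :
    restr (succP m) (an 0 1 v) M =
      jw key (p01 m) (M.map (succP m)) * v (insert (p01 m) (M.map (succP m))) := by
  rw [an_of_lt (by simp), restr_apply, ann_apply, if_neg (p01_notMem_map M)]

end Boundary

theorem wt_insert_map (M : Finset (P (m + 1))) (w : Fin (m + 2) → ℤ) (h0 : w 0 = 2)
    (hn : 2 ≤ m + 2) : wt (insert (p01 m) (M.map (succP m))) = w ↔ wt M = vshift hn w := by
  have e0 : wt (insert (p01 m) (M.map (succP m))) 0 = w 0 := by
    rw [wt_apply, Finset.sum_insert (p01_notMem_map M), Finset.sum_map, h0]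
    simp [wtP]
  have e1 : ∀ i : Fin (m + 1), wt (insert (p01 m) (M.map (succP m))) i.succ =
      wt M i + if i = 0 then 0 else 1 := by
    intro i
    rw [wt_apply, wt_apply, Finset.sum_insert (p01_notMem_map M), Finset.sum_map]
    have h1 : wtP (p01 m) i.succ = if i = 0 then -1 else 0 := by
      cases i using Fin.cases with
      | zero => simp [wtP]
      | succ i => simp [wtP, Fin.ext_iff]
    have h2 : ∀ p, wtP (succP m p) i.succ = wtP p i := by simp [wtP]
    simp only [h1, h2, Fin.val_succ]
    split_ifs <;> push_cast <;> ring
  have e2 : ∀ i : Fin (m + 1), w i.succ = vshift hn w i + if i = 0 then 0 else 1 := by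
    intro i
    cases i using Fin.cases with
    | zero => simp [vshift]
    | succ i => simp [vshift]; rfl
  constructor
  · intro h
    refine funext fun i => ?_
    have := congrFun h i.succ
    rw [e1, e2] at this
    exact add_right_cancel this
  · intro h
    refine funext fun i => ?_
    cases i using Fin.cases with
    | zero => exact e0
    | succ i => rw [e1, e2, h]

theorem card_insert_map (M : Finset (P (m + 1))) :
    ((insert (p01 m) (M.map (succP m))).card : ℤ) = M.card + 1 := by
  rw [Finset.card_insert_of_notMem (p01_notMem_map M), Finset.card_map]
  push_cast
  rfl

theorem exists_insert_map {N : Finset (P (m + 2))} (h : p01 m ∈ N) (h' : wt N 0 = 2) :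
    ∃ M : Finset (P (m + 1)), N = insert (p01 m) (M.map (succP m)) := by
  have h1 : (N.filter fun p => p.1.1 = 0).card = 1 := by
    have h2 : (N.filter fun p => p.1.2 = 0) = ∅ :=
      Finset.filter_eq_empty_iff.2 fun p _ => (Fin.pos_of_ne_zero p.2.ne_bot).ne'
    rw [wt, h2] at h'
    simp at h'
    omega
  obtain ⟨q, hq⟩ := Finset.card_eq_one.1 h1
  have h3 : ∀ p ∈ N, p.1.1 = 0 → p = p01 m := by
    have : p01 m = q := Finset.mem_singleton.1 (hq ▸ Finset.mem_filter.2 ⟨h, rfl⟩)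
    intro p hp hp0
    rw [this]
    exact Finset.mem_singleton.1 (hq ▸ Finset.mem_filter.2 ⟨hp, hp0⟩)
  refine ⟨Finset.univ.filter fun p => succP m p ∈ N, ?_⟩
  ext p
  simp only [Finset.mem_insert, Finset.mem_map, Finset.mem_filter, Finset.mem_univ, true_and]
  constructor
  · intro hp
    by_cases hp0 : p.1.1 = 0
    · exact Or.inl (h3 p hp hp0)
    · obtain ⟨⟨x, y⟩, hxy⟩ := p
      obtain ⟨x, rfl⟩ := Fin.exists_succ_eq.2 hp0
      obtain ⟨y, rfl⟩ := Fin.exists_succ_eq.2 (Fin.ne_zero_of_lt hxy)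
      exact Or.inr ⟨⟨(x, y), Fin.succ_lt_succ_iff.1 hxy⟩, hp, rfl⟩
  · rintro (rfl | ⟨q, hq, rfl⟩)
    · exact h
    · exact hq

/-- Extension by zero along `succP`. -/
noncomputable def extend (u : Fock (P (m + 1))) : Fock (P (m + 2)) :=
  Function.extend (Finset.map (succP m)) u 0

theorem restr_an_cr_extend (u : Fock (P (m + 1))) :
    restr (succP m) (an 0 1 (cr 0 1 (extend u))) = u := by
  have h := LinearMap.congr_fun (an_mul_cr_self (m := m)) (extend u)
  simp only [Module.End.mul_apply, LinearMap.sub_apply, Module.End.one_apply] at h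
  rw [h, map_sub, restr_cr_zero, sub_zero]
  exact funext fun M => (Finset.map_injective (succP m)).extend_apply u 0 M

theorem cr_extend_mem_Gr {k : ℤ} {w : Fin (m + 2) → ℤ} (h0 : w 0 = 2) (hn : 2 ≤ m + 2)
    {u : Fock (P (m + 1))} (hu : u ∈ Gr (m + 1) k (vshift hn w)) :
    cr 0 1 (extend u) ∈ Gr (m + 2) (k + 1) w := by
  intro N hN
  rw [cr_of_lt (by simp), cre_apply] at hN
  split_ifs at hN with h
  · have h1 := right_ne_zero_of_mul hN
    by_cases h2 : ∃ M : Finset (P (m + 1)), M.map (succP m) = N.erase (p01 m)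
    · obtain ⟨M, hM⟩ := h2
      rw [← hM, extend, (Finset.map_injective (succP m)).extend_apply] at h1
      have h3 : N = insert (p01 m) (M.map (succP m)) := by rw [hM, Finset.insert_erase h]
      obtain ⟨h4, h5⟩ := hu M h1
      rw [h3, card_insert_map, h4]
      exact ⟨rfl, (wt_insert_map M w h0 hn).2 h5⟩
    · exact absurd (Function.extend_apply' _ _ _ h2) h1
  · exact absurd rfl hN

theorem restr_an_mem_Gr {k : ℤ} {w : Fin (m + 2) → ℤ} (h0 : w 0 = 2) (hn : 2 ≤ m + 2)
    {v : Fock (P (m + 2))} (hv : v ∈ Gr (m + 2) (k + 1) w) :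
    restr (succP m) (an 0 1 v) ∈ Gr (m + 1) k (vshift hn w) := by
  intro M hM
  rw [restr_an_zero_one_apply] at hM
  obtain ⟨h1, h2⟩ := hv _ (right_ne_zero_of_mul hM)
  rw [card_insert_map] at h1
  exact ⟨add_right_cancel h1, (wt_insert_map M w h0 hn).1 h2⟩

theorem eq_zero_of_restr_an_eq_zero {k : ℤ} {w : Fin (m + 2) → ℤ} (h0 : w 0 = 2)
    {v : Fock (P (m + 2))} (hv : v ∈ Gr (m + 2) k w) (h : avoid m v = 0)
    (h' : restr (succP m) (an 0 1 v) = 0) : v = 0 := by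
  refine funext fun N => ?_
  by_contra hN
  by_cases hp : p01 m ∈ N
  · obtain ⟨M, rfl⟩ := exists_insert_map hp (by rw [(hv N hN).2, h0])
    have h1 := congrFun h' M
    rw [restr_an_zero_one_apply] at h1
    refine (mul_ne_zero ?_ hN) h1
    exact left_ne_zero_of_mul_eq_one (jw_mul_self _ _ _)
  · have h1 := congrFun h N
    rw [avoid_apply, if_neg hp] at h1
    exact hN h1

/-- The wedges of weight `w` containing `e_{12}` form an acyclic complex. -/
theorem exists_bd₀_eq {k : ℤ} {w : Fin (m + 2) → ℤ} (h0 : w 0 = 2) (hn : 2 ≤ m + 2)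
    (hw : ∀ k, Subsingleton (Hw (m + 1) k (vshift hn w)))
    {y : Fock (P (m + 2))} (hy : y ∈ Gr (m + 2) k w) (hy0 : avoid m y = 0) (hy1 : bd₀ m y = 0) :
    ∃ u ∈ Gr (m + 2) (k + 1) w, avoid m u = 0 ∧ bd₀ m u = y := by
  have hr : ∀ v, restr (succP m) (an 0 1 (bd₀ m v)) =
      -bd (m + 1) (restr (succP m) (an 0 1 v)) := by
    intro v
    have h := LinearMap.congr_fun (an_mul_bd₀ (m := m)) v
    simp only [Module.End.mul_apply, LinearMap.neg_apply] at h
    rw [h, map_neg, restr_bd₀]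
  obtain ⟨k, rfl⟩ : ∃ l, k = l + 1 := ⟨k - 1, by ring⟩
  obtain ⟨u, hu, hu1⟩ := exists_bd_eq_of_subsingleton (hw k) (restr_an_mem_Gr h0 hn hy)
    (by rw [← neg_eq_zero, ← hr, hy1]; simp)
  have hu2 := cr_extend_mem_Gr h0 hn hu
  have hu3 : avoid m (cr 0 1 (extend u)) = 0 := LinearMap.congr_fun avoid_mul_cr _
  have hu4 : avoid m (bd₀ m (cr 0 1 (extend u))) = 0 := by
    have h := LinearMap.congr_fun (avoid_mul_bd₀ (m := m)) (cr 0 1 (extend u))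
    simp only [Module.End.mul_apply] at h
    rw [h, hu3, map_zero]
  have hz : y + bd₀ m (cr 0 1 (extend u)) = 0 := by
    refine eq_zero_of_restr_an_eq_zero h0 (add_mem hy (bd₀_mem_Gr hu2)) ?_ ?_
    · rw [map_add, hy0, hu4, add_zero]
    · rw [map_add, map_add, hr, restr_an_cr_extend, hu1, add_neg_cancel]
  refine ⟨-cr 0 1 (extend u), neg_mem hu2, by rw [map_neg, hu3, neg_zero], ?_⟩
  rw [map_neg]
  exact neg_eq_of_add_eq_zero_left hz

end Restrict

section Comparison

variable {m : ℕ} {w : Fin (m + 2) → ℤ} {hn : 2 ≤ m + 2}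

theorem rot2_rot (h0 : w 0 = 2) (i : Fin (m + 2)) : rot2 hn w (rot m i) = w i := by
  refine Fin.cases ?_ (fun i => Fin.cases ?_ (fun i => ?_) i) i
  · simp [rot2, h0]
  · simp [rot2]
  · have := i.isLt
    simp [rot2, this.ne]; rfl

theorem wt_permWedge_rot (h0 : w 0 = 2) (M : Finset (P (m + 2))) :
    wt (permWedge (rot m) M) = rot2 hn w ↔ wt M = w := by
  rw [funext_iff, (rot m).surjective.forall, funext_iff]
  simp only [wt_permWedge, rot2_rot h0]

theorem mem_Gr_rot2 (h0 : w 0 = 2) {k : ℤ} {x : Fock (P (m + 2))} :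
    x ∈ Gr (m + 2) k (rot2 hn w) ↔ ∀ M, permFock (rot m) x M ≠ 0 →
      (M.card : ℤ) = k + (2 * w 1 - m - 4) + (if p01 m ∈ M then 2 else 0) ∧ wt M = w := by
  rw [Gr, mem_Supp, (permWedge (rot m)).surjective.forall]
  simp only [permFock_apply_ne_zero, wt_permWedge_rot h0, card_permWedge_rot]
  refine forall_congr' fun M => imp_congr_right fun _ => and_congr_left fun h => ?_
  rw [h]
  constructor <;> intro h <;> linarith

theorem avoid_permFock_mem_Gr (h0 : w 0 = 2) {k : ℤ} {x : Fock (P (m + 2))}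
    (hx : x ∈ Gr (m + 2) (k - (2 * w 1 - m - 4)) (rot2 hn w)) :
    avoid m (permFock (rot m) x) ∈ Gr (m + 2) k w := by
  intro M hM
  rw [avoid_apply] at hM
  split_ifs at hM with h
  · exact absurd rfl hM
  · simpa [h] using (mem_Gr_rot2 h0).1 hx M hM

theorem notMem_of_avoid_eq_self {v : Fock (P (m + 2))} (hv : avoid m v = v)
    {M : Finset (P (m + 2))} (hM : v M ≠ 0) : p01 m ∉ M := by
  intro h
  rw [← hv, avoid_apply, if_pos h] at hM
  exact hM rfl

theorem mem_of_avoid_eq_zero {v : Fock (P (m + 2))} (hv : avoid m v = 0)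
    {M : Finset (P (m + 2))} (hM : v M ≠ 0) : p01 m ∈ M := by
  by_contra h
  have h1 := congrFun hv M
  rw [avoid_apply, if_neg h] at h1
  exact hM h1

theorem mem_Gr_of_avoid_eq_zero (h0 : w 0 = 2) {k : ℤ} {x : Fock (P (m + 2))}
    (h : avoid m (permFock (rot m) x) = 0) :
    x ∈ Gr (m + 2) (k - (2 * w 1 - m - 4)) (rot2 hn w) ↔
      permFock (rot m) x ∈ Gr (m + 2) (k + 2) w := by
  rw [mem_Gr_rot2 h0, Gr, mem_Supp]
  refine forall_congr' fun M => imp_congr_right fun hM => ?_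
  rw [if_pos (mem_of_avoid_eq_zero h hM), sub_add_cancel]

theorem mem_Gr_of_avoid_eq_self (h0 : w 0 = 2) {k : ℤ} {x : Fock (P (m + 2))}
    (h : avoid m (permFock (rot m) x) = permFock (rot m) x)
    (hx : permFock (rot m) x ∈ Gr (m + 2) k w) :
    x ∈ Gr (m + 2) (k - (2 * w 1 - m - 4)) (rot2 hn w) := by
  rw [mem_Gr_rot2 h0]
  intro M hM
  rw [if_neg (notMem_of_avoid_eq_self h hM), sub_add_cancel, add_zero]
  exact hx M hM

theorem avoid_avoid (v : Fock (P (m + 2))) : avoid m (avoid m v) = avoid m v := by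
  refine funext fun M => ?_
  simp only [avoid_apply]
  split_ifs <;> rfl

theorem avoid_bd₀ (v : Fock (P (m + 2))) : avoid m (bd₀ m v) = bd₀ m (avoid m v) :=
  LinearMap.congr_fun avoid_mul_bd₀ v

theorem avoid_bd₁ (v : Fock (P (m + 2))) : avoid m (bd₁ m v) = bd₁ m v :=
  LinearMap.congr_fun avoid_mul_bd₁ v

theorem bd_apply (v : Fock (P (m + 2))) : bd (m + 2) v = bd₀ m v + bd₁ m v := by
  rw [bd_eq_bd₀_add_bd₁, LinearMap.add_apply]

theorem bd_apply' (v : Fock (P (m + 2))) : bd (m + 2) v = bd₀' m v + bd₁' m v := by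
  rw [bd_eq_bd₀'_add_bd₁', LinearMap.add_apply]

theorem avoid_permFock_bd (x : Fock (P (m + 2))) :
    avoid m (permFock (rot m) (bd (m + 2) x)) = bd (m + 2) (avoid m (permFock (rot m) x)) := by
  have h1 : avoid m (permFock (rot m) (bd₁' m x)) = 0 := by
    rw [rot_bd₁', map_sum]
    exact Finset.sum_eq_zero fun y _ => LinearMap.congr_fun avoid_mul_cr _
  have h2 : bd₁ m (avoid m (permFock (rot m) x)) = 0 := LinearMap.congr_fun bd₁_mul_avoid _
  rw [bd_apply', map_add, map_add, h1, rot_bd₀', avoid_bd₀, bd_apply, h2]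

theorem nonempty_Hw_rot2_equiv (h0 : w 0 = 2)
    (hw : ∀ k, Subsingleton (Hw (m + 1) k (vshift hn w))) (k : ℤ) :
    Nonempty (Hw (m + 2) (k - (2 * w 1 - m - 4)) (rot2 hn w) ≃ₗ[ℤ] Hw (m + 2) k w) := by
  have hk : ∀ s : ℤ, k - (2 * w 1 - m - 4) + s = k + s - (2 * w 1 - m - 4) := fun s => by ring
  refine nonempty_Hw_equiv (avoid m ∘ₗ (permFock (rot m)).toLinearMap) ?_ avoid_permFock_bd ?_ ?_
  · intro s x hx
    rw [hk] at hx
    exact avoid_permFock_mem_Gr h0 hx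
  · intro s x hx hgx hbx
    replace hgx : avoid m (permFock (rot m) x) = 0 := hgx
    rw [bd_apply', bd₁'_eq_zero hgx, add_zero] at hbx
    rw [hk, mem_Gr_of_avoid_eq_zero h0 hgx] at hx
    obtain ⟨u, hu, hu0, hu1⟩ := exists_bd₀_eq h0 hn hw hx hgx (by rw [← rot_bd₀', hbx, map_zero])
    obtain ⟨u, rfl⟩ := (permFock (rot m)).surjective u
    refine ⟨u, ?_, hu0, (permFock (rot m)).injective ?_⟩
    · rw [add_assoc, hk, mem_Gr_of_avoid_eq_zero h0 hu0]
      rwa [show k + (s + 1) + 2 = k + s + 2 + 1 by ring]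
    · rw [bd_apply', bd₁'_eq_zero hu0, add_zero, rot_bd₀', hu1]
  · rintro s a ha ⟨b, hb⟩
    have h1 : bd₀ m (a - avoid m a) = 0 := by
      have h : avoid m (bd (m + 2) a) = bd (m + 2) a := by rw [hb]; exact avoid_avoid _
      rw [bd_apply, map_add, avoid_bd₁, avoid_bd₀, add_left_inj] at h
      rw [map_sub, h, sub_self]
    obtain ⟨u, hu, -, hu1⟩ := exists_bd₀_eq h0 hn hw (sub_mem ha (avoid_mem_Gr ha))
      (by rw [map_sub, avoid_avoid, sub_self]) h1
    obtain ⟨c, hc⟩ := (permFock (rot m)).surjective (avoid m a - bd₁ m u)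
    have hc' : avoid m (permFock (rot m) c) = permFock (rot m) c := by
      rw [hc, map_sub, avoid_avoid, avoid_bd₁]
    refine ⟨u, hu, c, ?_, ?_⟩
    · rw [hk]
      refine mem_Gr_of_avoid_eq_self h0 hc' ?_
      rw [hc]
      exact sub_mem (avoid_mem_Gr ha) (bd₁_mem_Gr hu)
    · rw [LinearMap.comp_apply, LinearEquiv.coe_coe, hc', hc, bd_apply, hu1]
      abel

end Comparison

/-- Lemma 3.3: for `w = (2, w₂, …, w_n)` and `w' = (2, w₃, …, w_n, w₂)`, if the complex
`⟦w₂, w₃-1, …, w_n-1⟧` (a weight summand of `Λ^* nil_{n-1}`) has vanishing homology, then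
`H_k⟦w⟧ ≅ H_{k-(2w₂-n-2)}⟦w'⟧` for all `k`. -/
theorem rotate_second_entry (n : ℕ) (hn : 2 ≤ n) (w : Fin n → ℤ) (hw : Sn n w)
    (h0 : w ⟨0, by omega⟩ = 2)
    (hacyclic : ∀ k : ℤ, Subsingleton (Hw (n - 1) k (vshift hn w))) :
    ∀ k : ℤ,
      Nonempty (Hw n k w ≃ₗ[ℤ] Hw n (k - (2 * w ⟨1, by omega⟩ - n - 2)) (rot2 hn w)) := by
  intro k
  obtain ⟨m, rfl⟩ : ∃ m, n = m + 2 := ⟨n - 2, by omega⟩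
  have h := (nonempty_Hw_rot2_equiv (hn := hn) h0 hacyclic k).map LinearEquiv.symm
  have e : k - (2 * w 1 - m - 4) = k - (2 * w ⟨1, by omega⟩ - (m + 2 : ℕ) - 2) := by
    push_cast
    rw [show (1 : Fin (m + 2)) = ⟨1, by omega⟩ from rfl]
    ring
  rwa [e] at h

end Nil
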